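/- arXiv:2204.07798 — 2 statements merged into one kernel-verified Lean document; each statement's English description precedes it below -/
import Mathlib

section
/- Let p, q, p', q' ≥ 3 and r, r' ≥ 1 be integers. If the graphs d(p,q,r) and d(p',q',r') have the same Laplacian permanental polynomial, i.e., per(xI − L(d(p,q,r))) = per(xI − L(d(p',q',r'))) as polynomials in x, then d(p,q,r) is isomorphic to d(p',q',r') (equivalently, r = r' and {p,q} = {p',q'} as unordered pairs). -/
open scoped Classical
open Polynomial

noncomputable section

/-- The Laplacian permanental polynomial `per(x·I − L(G))` of a graph `G`,
where `L(G) = D(G) − A(G)` is the Laplacian matrix. -/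
def lapPermPoly {V : Type*} [Fintype V] (G : SimpleGraph V) : Polynomial ℚ :=
  Matrix.permanent
    (Matrix.diagonal (fun _ : V => (X : Polynomial ℚ)) - (G.lapMatrix ℚ).map Polynomial.C)

/-- The bicyclic graph `d(p,q,r)` on `p + q + r` vertices: vertices `0, …, p-1` form the
cycle `C_p`, vertices `p, …, p+q-1` form the cycle `C_q`, and vertices `p+q, …, p+q+r-1`
form a path of `r` internal vertices whose ends are joined to vertex `0` of `C_p` and to
vertex `p` of `C_q` (i.e. a path on `r + 2` vertices has each end vertex identified with a
vertex of one of the two cycles). -/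
def dGraph (p q r : ℕ) : SimpleGraph (Fin (p + q + r)) :=
  SimpleGraph.fromRel (fun i j =>
    (i.val + 1 = j.val ∧ j.val < p) ∨
    (i.val = p - 1 ∧ j.val = 0) ∨
    (i.val + 1 = j.val ∧ p ≤ i.val ∧ j.val < p + q) ∨
    (i.val = p + q - 1 ∧ j.val = p) ∨
    (i.val + 1 = j.val ∧ p + q ≤ i.val) ∨
    (i.val = 0 ∧ j.val = p + q) ∨
    (i.val = p + q + r - 1 ∧ j.val = p))


/-- Sum over all bijections of the products of entries (a permanent with possibly distinct
index types). -/
def pmT {α β : Type} [Fintype α] [Fintype β] (M : α → β → ℚ) : ℚ :=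
  ∑ e : α ≃ β, ∏ i, M i (e i)

lemma pmT_congr {α β α' β' : Type} {_ : Fintype α} {_ : Fintype β} {_ : Fintype α'}
    {_ : Fintype β'}
    (f : α' ≃ α) (g : β' ≃ β) (M : α → β → ℚ) (M' : α' → β' → ℚ)
    (h : ∀ a b, M' a b = M (f a) (g b)) : pmT M' = pmT M := by
  unfold pmT
  refine Fintype.sum_equiv (Equiv.equivCongr f g) _ _ (fun e => ?_)
  refine Fintype.prod_equiv f _ _ (fun a => ?_)
  simp [h]

lemma pmT_transpose {α β : Type} [Fintype α] [Fintype β] (M : α → β → ℚ) :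
    pmT M = pmT (fun b a => M a b) := by
  unfold pmT
  refine Fintype.sum_equiv ⟨Equiv.symm, Equiv.symm, fun _ => rfl, fun _ => rfl⟩ _ _ (fun e => ?_)
  refine Fintype.prod_equiv e _ _ (fun a => ?_)
  simp

lemma pmT_option {α β : Type} [Fintype α] [Fintype β] (M : Option α → β → ℚ) :
    pmT M = ∑ x, M none x * pmT (fun (a : α) (b : {y : β // y ≠ x}) => M (some a) b) := by
  refine Eq.trans (b := ∑ e : Option α ≃ β, ∏ i, M i (e i)) (by unfold pmT; congr!) ?_
  unfold pmT
  rw [← Finset.sum_fiberwise (s := Finset.univ) (g := fun e : Option α ≃ β => e none)]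
  refine Finset.sum_congr rfl (fun x _ => ?_)
  rw [Finset.mul_sum]
  rw [Finset.sum_subtype (p := fun e : Option α ≃ β => e none = x) _ (by simp)]
  refine Eq.trans (b := ∑ e : α ≃ {y : β // y ≠ x}, M none x * ∏ i, M (some i) (e i)) ?_
    (by congr!)
  refine Fintype.sum_equiv (Equiv.optionSubtype x) _ _ (fun e => ?_)
  rw [Fintype.prod_option, e.2]
  rfl

/-- Permanent of the submatrix with rows `S` and columns `T`. -/
def pm (M : ℕ → ℕ → ℚ) (S T : Finset ℕ) : ℚ :=
  pmT (fun (i : S) (j : T) => M i j)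

lemma pm_transpose (M : ℕ → ℕ → ℚ) (S T : Finset ℕ) :
    pm M S T = pm (fun i j => M j i) T S := pmT_transpose _

lemma pm_empty (M : ℕ → ℕ → ℚ) : pm M ∅ ∅ = 1 := by
  unfold pm pmT
  simp

lemma pm_row (M : ℕ → ℕ → ℚ) (S T : Finset ℕ) (i : ℕ) (hi : i ∈ S) :
    pm M S T = ∑ j ∈ T, M i j * pm M (S.erase i) (T.erase j) := by
  let e : Option (S.erase i : Finset ℕ) ≃ S :=
    { toFun := fun o => o.elim ⟨i, hi⟩ (fun z => ⟨z, Finset.mem_of_mem_erase z.2⟩)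
      invFun := fun x => if h : (x : ℕ) = i then none
        else some ⟨x, Finset.mem_erase.2 ⟨h, x.2⟩⟩
      left_inv := by rintro (_ | y) <;> grind
      right_inv := by intro y; grind }
  unfold pm
  refine Eq.trans (b := pmT (fun (o : Option (S.erase i : Finset ℕ)) (j : T) => M (e o) j))
    (Eq.symm (pmT_congr e (Equiv.refl T) _ _ (fun _ _ => rfl))) ?_
  rw [pmT_option, ← Finset.sum_coe_sort T (fun j => M i j * _)]
  refine Finset.sum_congr rfl (fun x _ => ?_)
  congr 1
  let g : {y : T // y ≠ x} ≃ (T.erase x : Finset ℕ) :=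
    { toFun := fun y => ⟨y, Finset.mem_erase.2 ⟨fun h => y.2 (Subtype.ext h), y.1.2⟩⟩
      invFun := fun y => ⟨⟨y, Finset.mem_of_mem_erase y.2⟩,
        fun h => Finset.ne_of_mem_erase y.2 (congrArg Subtype.val h)⟩
      left_inv := fun y => rfl
      right_inv := fun y => rfl }
  exact pmT_congr (Equiv.refl (S.erase i : Finset ℕ)) g (fun i j => M i j) _ (fun _ _ => rfl)

lemma pm_col (M : ℕ → ℕ → ℚ) (S T : Finset ℕ) (j : ℕ) (hj : j ∈ T) :
    pm M S T = ∑ i ∈ S, M i j * pm M (S.erase i) (T.erase j) := by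
  rw [pm_transpose, pm_row _ _ _ j hj]
  refine Finset.sum_congr rfl (fun x _ => ?_)
  rw [← pm_transpose]

lemma pm_block (M : ℕ → ℕ → ℚ) (A : Finset ℕ) : ∀ (B C D : Finset ℕ),
    Disjoint A B → Disjoint C D → (∀ a ∈ A, ∀ d ∈ D, M a d = 0) → A.card = C.card →
    pm M (A ∪ B) (C ∪ D) = pm M A C * pm M B D := by
  induction A using Finset.induction_on with
  | empty =>
    intro B C D _ _ _ hc
    have : C = ∅ := by simpa using hc.symm
    subst this
    simp [pm_empty]
  | insert a A ha ih =>
    intro B C D hAB hCD hz hc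
    rw [pm_row M (insert a A ∪ B) _ a (by simp), pm_row M (insert a A) _ a (by simp),
      Finset.sum_union hCD, Finset.sum_mul]
    rw [Finset.sum_eq_zero (s := D) (fun d hd => by rw [hz a (by simp) d hd, zero_mul]), add_zero]
    refine Finset.sum_congr rfl (fun c hc' => ?_)
    have haB : a ∉ B := Finset.disjoint_left.1 hAB (by simp)
    have hcD : c ∉ D := Finset.disjoint_left.1 hCD hc'
    have h1 : (insert a A ∪ B).erase a = A ∪ B := by
      ext x; simp only [Finset.mem_erase, Finset.mem_union, Finset.mem_insert]; grind
    have h2 : (C ∪ D).erase c = C.erase c ∪ D := by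
      ext x; simp only [Finset.mem_erase, Finset.mem_union]; grind
    rw [h1, h2, Finset.erase_insert ha, mul_assoc]
    rw [ih B (C.erase c) D (Finset.disjoint_of_subset_left (by simp) hAB)
      (Finset.disjoint_of_subset_left (Finset.erase_subset _ _) hCD)
      (fun x hx => hz x (by simp [hx]))]
    rw [Finset.card_erase_of_mem hc', ← hc, Finset.card_insert_of_notMem ha]
    simp

lemma pm_block_zero (M : ℕ → ℕ → ℚ) (A : Finset ℕ) : ∀ (B C D : Finset ℕ),
    Disjoint A B → Disjoint C D → (∀ a ∈ A, ∀ d ∈ D, M a d = 0) → C.card < A.card →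
    pm M (A ∪ B) (C ∪ D) = 0 := by
  induction A using Finset.induction_on with
  | empty =>
    intro B C D _ _ _ hc
    simp at hc
  | insert a A ha ih =>
    intro B C D hAB hCD hz hc
    rw [pm_row M (insert a A ∪ B) _ a (by simp), Finset.sum_union hCD]
    rw [Finset.sum_eq_zero (s := D) (fun d hd => by rw [hz a (by simp) d hd, zero_mul]), add_zero]
    refine Finset.sum_eq_zero (fun c hc' => ?_)
    have haB : a ∉ B := Finset.disjoint_left.1 hAB (by simp)
    have hcD : c ∉ D := Finset.disjoint_left.1 hCD hc'
    have h1 : (insert a A ∪ B).erase a = A ∪ B := by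
      ext x; simp only [Finset.mem_erase, Finset.mem_union, Finset.mem_insert]; grind
    have h2 : (C ∪ D).erase c = C.erase c ∪ D := by
      ext x; simp only [Finset.mem_erase, Finset.mem_union]; grind
    rw [h1, h2, ih B (C.erase c) D (Finset.disjoint_of_subset_left (by simp) hAB)
      (Finset.disjoint_of_subset_left (Finset.erase_subset _ _) hCD)
      (fun x hx => hz x (by simp [hx])), mul_zero]
    have := Finset.card_pos.2 ⟨c, hc'⟩
    rw [Finset.card_insert_of_notMem ha] at hc
    rw [Finset.card_erase_of_mem hc']
    omega

/-- Bridge decomposition. -/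
lemma pm_bridge (M : ℕ → ℕ → ℚ) (A B : Finset ℕ) (u v : ℕ) (hu : u ∈ A) (hv : v ∈ B)
    (hAB : Disjoint A B) (huv : M u v = 1) (hvu : M v u = 1)
    (h1 : ∀ a ∈ A, ∀ b ∈ B, ¬ (a = u ∧ b = v) → M a b = 0)
    (h2 : ∀ a ∈ A, ∀ b ∈ B, ¬ (a = u ∧ b = v) → M b a = 0) :
    pm M (A ∪ B) (A ∪ B) =
      pm M A A * pm M B B + pm M (A.erase u) (A.erase u) * pm M (B.erase v) (B.erase v) := by
  have huB : u ∉ B := Finset.disjoint_left.1 hAB hu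
  have hvA : v ∉ A := Finset.disjoint_right.1 hAB hv
  have dis : ∀ x, x ∈ A → x ∈ B → False := fun x h h' => Finset.disjoint_left.1 hAB h h'
  rw [pm_row M (A ∪ B) _ u (by simp [hu]), Finset.sum_union hAB]
  congr 1
  · rw [pm_row M A _ u hu, Finset.sum_mul]
    refine Finset.sum_congr rfl (fun j hj => ?_)
    have e1 : (A ∪ B).erase u = A.erase u ∪ B := by
      ext x; simp only [Finset.mem_erase, Finset.mem_union]; grind
    have e2 : (A ∪ B).erase j = A.erase j ∪ B := by
      ext x; simp only [Finset.mem_erase, Finset.mem_union]; grind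
    rw [e1, e2, mul_assoc, pm_block M _ _ _ _
      (Finset.disjoint_of_subset_left (Finset.erase_subset _ _) hAB)
      (Finset.disjoint_of_subset_left (Finset.erase_subset _ _) hAB)]
    · intro a ha d hd
      exact h1 a (Finset.mem_of_mem_erase ha) d hd (fun h => Finset.ne_of_mem_erase ha h.1)
    · rw [Finset.card_erase_of_mem hu, Finset.card_erase_of_mem hj]
  · rw [Finset.sum_eq_single v (fun b hb hbv => by
      rw [h1 u hu b hb (fun h => hbv h.2), zero_mul]) (fun h => absurd hv h), huv, one_mul]
    rw [pm_col M _ _ u (by simp [hu]; rintro rfl; exact hvA hu)]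
    rw [Finset.sum_eq_single v]
    · rw [hvu, one_mul]
      have e1 : ((A ∪ B).erase u).erase v = A.erase u ∪ B.erase v := by
        ext x; simp only [Finset.mem_erase, Finset.mem_union]; grind
      have e2 : ((A ∪ B).erase v).erase u = A.erase u ∪ B.erase v := by
        ext x; simp only [Finset.mem_erase, Finset.mem_union]; grind
      have dd : Disjoint (A.erase u) (B.erase v) :=
        Finset.disjoint_of_subset_left (Finset.erase_subset _ _)
          (Finset.disjoint_of_subset_right (Finset.erase_subset _ _) hAB)
      rw [e1, e2, pm_block M _ _ _ _ dd dd _ rfl]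
      intro a ha d hd
      exact h1 a (Finset.mem_of_mem_erase ha) d (Finset.mem_of_mem_erase hd)
        (fun h => Finset.ne_of_mem_erase ha h.1)
    · intro a ha hav
      rcases Finset.mem_union.1 (Finset.mem_of_mem_erase ha) with haA | haB
      · have e1 : ((A ∪ B).erase u).erase a = B ∪ (A.erase u).erase a := by
          ext x; simp only [Finset.mem_erase, Finset.mem_union]; grind
        have e2 : ((A ∪ B).erase v).erase u = B.erase v ∪ A.erase u := by
          ext x; simp only [Finset.mem_erase, Finset.mem_union]; grind
        rw [e1, e2, pm_block_zero, mul_zero]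
        · exact (Finset.disjoint_of_subset_left ((Finset.erase_subset _ _).trans
            (Finset.erase_subset _ _)) hAB).symm
        · exact (Finset.disjoint_of_subset_left (Finset.erase_subset _ _)
            (Finset.disjoint_of_subset_right (Finset.erase_subset _ _) hAB)).symm
        · intro b hb d hd
          exact h2 d (Finset.mem_of_mem_erase hd) b hb (fun h => Finset.ne_of_mem_erase hd h.1)
        · exact Finset.card_erase_lt_of_mem hv
      · rw [h2 u hu a haB (fun h => hav h.2), zero_mul]
    · intro h
      exfalso; apply h
      simp only [Finset.mem_erase, Finset.mem_union]
      exact ⟨fun h => hvA (h ▸ hu), Or.inr hv⟩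

/-- Fibonacci polynomials. -/
def fibU (y : ℚ) : ℕ → ℚ
  | 0 => 0
  | 1 => 1
  | (n + 2) => y * fibU y (n + 1) + fibU y n

lemma pm_path (M : ℕ → ℕ → ℚ) (y : ℚ) (k : ℕ) : ∀ a,
    (∀ i j, a ≤ i → i < a + k → a ≤ j → j < a + k →
      M i j = if i = j then y else if i + 1 = j ∨ j + 1 = i then 1 else 0) →
    pm M (Finset.Ico a (a + k)) (Finset.Ico a (a + k)) = fibU y (k + 1) := by
  induction k using Nat.twoStepInduction with
  | zero => intro a _; simp [pm_empty, fibU]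
  | one =>
    intro a h
    rw [Nat.Ico_succ_singleton, pm_row M _ _ a (by simp)]
    have := h a a
    simp at this
    simp [pm_empty, fibU, this]
  | more k ih1 ih2 =>
    intro a h
    have e : Finset.Ico a (a + (k + 2)) = {a} ∪ Finset.Ico (a + 1) (a + 1 + (k + 1)) := by
      ext x; simp only [Finset.mem_union, Finset.mem_singleton, Finset.mem_Ico]; omega
    have e2 : (Finset.Ico (a + 1) (a + 1 + (k + 1))).erase (a + 1)
        = Finset.Ico (a + 2) (a + 2 + k) := by
      ext x; simp only [Finset.mem_erase, Finset.mem_Ico]; omega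
    rw [e, pm_bridge M {a} (Finset.Ico (a + 1) (a + 1 + (k + 1))) a (a + 1)]
    · rw [e2, ih2 (a + 1), ih1 (a + 2), pm_row M {a} _ a (by simp)]
      · have := h a a
        simp at this
        have e4 : fibU y (k + 2 + 1) = y * fibU y (k + 1 + 1) + fibU y (k + 1) := rfl
        rw [e4]
        simp [pm_empty, this]
      · intro i j _ _ _ _
        apply h <;> omega
      · intro i j _ _ _ _
        apply h <;> omega
    · simp
    · simp
    · simp
    · rw [h _ _ (by omega) (by omega) (by omega) (by omega)]; simp
    · rw [h _ _ (by omega) (by omega) (by omega) (by omega)]; simp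
    · intro i hi b hb hn
      simp only [Finset.mem_singleton, Finset.mem_Ico] at hi hb
      rw [h _ _ (by omega) (by omega) (by omega) (by omega), if_neg (by omega), if_neg (by omega)]
    · intro i hi b hb hn
      simp only [Finset.mem_singleton, Finset.mem_Ico] at hi hb
      rw [h _ _ (by omega) (by omega) (by omega) (by omega), if_neg (by omega), if_neg (by omega)]

lemma pm_shift (M : ℕ → ℕ → ℚ) (k : ℕ) : ∀ a,
    (∀ i, a ≤ i → i < a + k → M i (i + 1) = 1) →
    (∀ i j, a ≤ i → i + 1 < j → j < a + 1 + k → M i j = 0) →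
    pm M (Finset.Ico a (a + k)) (Finset.Ico (a + 1) (a + 1 + k)) = 1 := by
  induction k with
  | zero => intro a _ _; simp [pm_empty]
  | succ k ih =>
    intro a h1 h2
    rw [pm_row M _ _ a (by simp), Finset.sum_eq_single (a + 1)]
    · have e1 : (Finset.Ico a (a + (k + 1))).erase a = Finset.Ico (a + 1) (a + 1 + k) := by
        ext x; simp only [Finset.mem_erase, Finset.mem_Ico]; omega
      have e2 : (Finset.Ico (a + 1) (a + 1 + (k + 1))).erase (a + 1)
          = Finset.Ico (a + 1 + 1) (a + 1 + 1 + k) := by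
        ext x; simp only [Finset.mem_erase, Finset.mem_Ico]; omega
      rw [e1, e2, h1 a (by omega) (by omega), ih (a + 1), mul_one]
      · intro i _ _; exact h1 i (by omega) (by omega)
      · intro i j _ _ _; exact h2 i j (by omega) (by omega) (by omega)
    · intro b hb hn
      simp only [Finset.mem_Ico] at hb
      rw [h2 a b (by omega) (by omega) (by omega), zero_mul]
    · intro h; simp at h

lemma pm_cycle (M : ℕ → ℕ → ℚ) (y z : ℚ) (k a : ℕ)
    (h : ∀ i j, a ≤ i → i < a + (k + 3) → a ≤ j → j < a + (k + 3) →
      M i j = if i = j then (if i = a then z else y) else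
        if i + 1 = j ∨ j + 1 = i ∨ (i = a ∧ j = a + k + 2) ∨ (j = a ∧ i = a + k + 2)
          then 1 else 0) :
    pm M (Finset.Ico a (a + (k + 3))) (Finset.Ico a (a + (k + 3))) =
      z * fibU y (k + 3) + 2 * fibU y (k + 2) + 2 := by
  have path : ∀ b l, a < b → b + l ≤ a + (k + 3) →
      pm M (Finset.Ico b (b + l)) (Finset.Ico b (b + l)) = fibU y (l + 1) := by
    intro b l hb hl
    apply pm_path
    intro i j _ _ _ _
    rw [h i j (by omega) (by omega) (by omega) (by omega)]
    split_ifs <;> first | rfl | omega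
  have sh1 : pm M (Finset.Ico (a + 1) (a + 1 + (k + 1))) (Finset.Ico (a + 2) (a + 2 + (k + 1)))
      = 1 := by
    apply pm_shift
    · intro i _ _
      rw [h _ _ (by omega) (by omega) (by omega) (by omega), if_neg (by omega), if_pos (by omega)]
    · intro i j _ _ _
      rw [h _ _ (by omega) (by omega) (by omega) (by omega), if_neg (by omega), if_neg (by omega)]
  have sh2 : pm M (Finset.Ico (a + 2) (a + 2 + (k + 1))) (Finset.Ico (a + 1) (a + 1 + (k + 1)))
      = 1 := by
    rw [pm_transpose]
    apply pm_shift
    · intro i _ _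
      rw [h _ _ (by omega) (by omega) (by omega) (by omega), if_neg (by omega), if_pos (by omega)]
    · intro i j _ _ _
      rw [h _ _ (by omega) (by omega) (by omega) (by omega), if_neg (by omega), if_neg (by omega)]
  have maa : M a a = z := by
    rw [h _ _ (by omega) (by omega) (by omega) (by omega)]; simp
  have m1 : M a (a + 1) = 1 := by
    rw [h _ _ (by omega) (by omega) (by omega) (by omega), if_neg (by omega), if_pos (by omega)]
  have m2 : M a (a + k + 2) = 1 := by
    rw [h _ _ (by omega) (by omega) (by omega) (by omega), if_neg (by omega), if_pos (by omega)]
  have m1' : M (a + 1) a = 1 := by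
    rw [h _ _ (by omega) (by omega) (by omega) (by omega), if_neg (by omega), if_pos (by omega)]
  have m2' : M (a + k + 2) a = 1 := by
    rw [h _ _ (by omega) (by omega) (by omega) (by omega), if_neg (by omega), if_pos (by omega)]
  -- expansion of the minors along column `a`
  have col : ∀ T : Finset ℕ, a ∈ T →
      pm M ((Finset.Ico a (a + (k + 3))).erase a) T =
        pm M (Finset.Ico (a + 2) (a + 2 + (k + 1))) (T.erase a) +
        pm M (Finset.Ico (a + 1) (a + 1 + (k + 1))) (T.erase a) := by
    intro T hT
    rw [pm_col M _ _ a hT]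
    rw [← Finset.sum_subset (s₁ := {a + 1, a + k + 2})]
    · rw [Finset.sum_pair (by omega), m1', m2', one_mul, one_mul]
      congr 2
      · ext x; simp only [Finset.mem_erase, Finset.mem_Ico]; omega
      · ext x; simp only [Finset.mem_erase, Finset.mem_Ico]; omega
    · intro x
      simp only [Finset.mem_insert, Finset.mem_singleton, Finset.mem_erase, Finset.mem_Ico]
      omega
    · intro x
      simp only [Finset.mem_insert, Finset.mem_singleton, Finset.mem_erase, Finset.mem_Ico]
      intro h1 h2
      rw [h _ _ (by omega) (by omega) (by omega) (by omega), if_neg (by omega),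
        if_neg (by omega), zero_mul]
  rw [pm_row M _ _ a (by simp)]
  rw [← Finset.sum_subset (s₁ := {a, a + 1, a + k + 2})]
  · rw [Finset.sum_insert (by simp; omega), Finset.sum_pair (by omega), maa, m1, m2]
    have e0 : (Finset.Ico a (a + (k + 3))).erase a = Finset.Ico (a + 1) (a + 1 + (k + 2)) := by
      ext x; simp only [Finset.mem_erase, Finset.mem_Ico]; omega
    rw [col ((Finset.Ico a (a + (k + 3))).erase (a + 1)) (by simp),
      col ((Finset.Ico a (a + (k + 3))).erase (a + k + 2))
        (by simp only [Finset.mem_erase, Finset.mem_Ico]; omega), e0]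
    have e1 : ((Finset.Ico a (a + (k + 3))).erase (a + 1)).erase a
        = Finset.Ico (a + 2) (a + 2 + (k + 1)) := by
      ext x; simp only [Finset.mem_erase, Finset.mem_Ico]; omega
    have e2 : ((Finset.Ico a (a + (k + 3))).erase (a + k + 2)).erase a
        = Finset.Ico (a + 1) (a + 1 + (k + 1)) := by
      ext x; simp only [Finset.mem_erase, Finset.mem_Ico]; omega
    rw [e1, e2, sh1, sh2, path _ _ (by omega) (by omega), path _ _ (by omega) (by omega),
      path _ _ (by omega) (by omega)]
    ring
  · intro x
    simp only [Finset.mem_insert, Finset.mem_singleton, Finset.mem_Ico]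
    omega
  · intro x
    simp only [Finset.mem_insert, Finset.mem_singleton, Finset.mem_Ico]
    intro h1 h2
    rw [h _ _ (by omega) (by omega) (by omega) (by omega), if_neg (by omega),
      if_neg (by omega), zero_mul]

/-- Adjacency of `d(p,q,r)` on natural numbers (unsymmetrised). -/
def relN (p q r i j : ℕ) : Prop :=
    (i + 1 = j ∧ j < p) ∨
    (i = p - 1 ∧ j = 0) ∨
    (i + 1 = j ∧ p ≤ i ∧ j < p + q) ∨
    (i = p + q - 1 ∧ j = p) ∨
    (i + 1 = j ∧ p + q ≤ i) ∨
    (i = 0 ∧ j = p + q) ∨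
    (i = p + q + r - 1 ∧ j = p)

/-- The matrix `xI - L`, with `y = x - 2`. -/
def matN (p q r : ℕ) (y : ℚ) (i j : ℕ) : ℚ :=
  if i = j then (if i = 0 ∨ i = p then y - 1 else y) else
    if relN p q r i j ∨ relN p q r j i then 1 else 0

/-- The permanent of a unicyclic piece. -/
def cycA (y : ℚ) (m : ℕ) : ℚ := (y - 1) * fibU y m + 2 * fibU y (m - 1) + 2

set_option maxHeartbeats 4000000 in
lemma pm_matN (p q r : ℕ) (y : ℚ) (hp : 3 ≤ p) (hq : 3 ≤ q) (hr : 1 ≤ r) :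
    pm (matN p q r y) (Finset.range (p + q + r)) (Finset.range (p + q + r)) =
      cycA y p * (cycA y q * fibU y (r + 1) + fibU y q * fibU y r) +
      fibU y p * (cycA y q * fibU y r + fibU y q * fibU y (r - 1)) := by
  have cp : pm (matN p q r y) (Finset.Ico 0 p) (Finset.Ico 0 p) = cycA y p := by
    obtain ⟨k, rfl⟩ : ∃ k, p = k + 3 := ⟨p - 3, by omega⟩
    have := pm_cycle (matN (k + 3) q r y) y (y - 1) k 0 (by
      intro i j _ _ _ _
      unfold matN relN
      split_ifs <;> first | rfl | omega)
    rw [zero_add] at this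
    rw [this, cycA]
    rfl
  have cq : pm (matN p q r y) (Finset.Ico p (p + q)) (Finset.Ico p (p + q)) = cycA y q := by
    obtain ⟨k, rfl⟩ : ∃ k, q = k + 3 := ⟨q - 3, by omega⟩
    rw [pm_cycle (matN p (k + 3) r y) y (y - 1) k p (by
      intro i j _ _ _ _
      unfold matN relN
      split_ifs <;> first | rfl | omega), cycA]
    rfl
  have path : ∀ b l, 0 < b → b + l ≤ p ∨ (p < b ∧ b + l ≤ p + q) ∨
      (p + q ≤ b ∧ b + l ≤ p + q + r) →
      pm (matN p q r y) (Finset.Ico b (b + l)) (Finset.Ico b (b + l)) = fibU y (l + 1) := by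
    intro b l hb hl
    apply pm_path
    intro i j _ _ _ _
    unfold matN relN
    split_ifs <;> first | rfl | omega
  have ep : (Finset.Ico 0 p).erase 0 = Finset.Ico 1 (1 + (p - 1)) := by
    ext x; simp only [Finset.mem_erase, Finset.mem_Ico]; omega
  have eq : (Finset.Ico p (p + q)).erase p = Finset.Ico (p + 1) ((p + 1) + (q - 1)) := by
    ext x; simp only [Finset.mem_erase, Finset.mem_Ico]; omega
  have right : ∀ j l, j + l = r →
      pm (matN p q r y) (Finset.Ico p (p + q) ∪ Finset.Ico (p + q + j) (p + q + j + l))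
        (Finset.Ico p (p + q) ∪ Finset.Ico (p + q + j) (p + q + j + l)) =
      cycA y q * fibU y (l + 1) + fibU y q * fibU y l := by
    intro j l hl
    rcases l with _ | l
    · simp [cq, fibU]
    have ee : (Finset.Ico (p + q + j) (p + q + j + (l + 1))).erase (p + q + j + l)
        = Finset.Ico (p + q + j) (p + q + j + l) := by
      ext x; simp only [Finset.mem_erase, Finset.mem_Ico]; omega
    rw [pm_bridge _ (Finset.Ico p (p + q)) _ p (p + q + j + l)]
    · rw [cq, eq, ee, path _ _ (by omega) (by omega), path _ _ (by omega) (by omega),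
        path _ _ (by omega) (by omega)]
      rw [show q - 1 + 1 = q by omega]
    · simp; omega
    · simp
    · rw [Finset.disjoint_left]; intro x; simp only [Finset.mem_Ico]; omega
    · unfold matN relN; rw [if_neg (by omega), if_pos (by omega)]
    · unfold matN relN; rw [if_neg (by omega), if_pos (by omega)]
    · intro i hi b hb hn
      simp only [Finset.mem_Ico] at hi hb
      unfold matN relN; rw [if_neg (by omega), if_neg (by omega)]
    · intro i hi b hb hn
      simp only [Finset.mem_Ico] at hi hb
      unfold matN relN; rw [if_neg (by omega), if_neg (by omega)]
  have e : Finset.range (p + q + r) = Finset.Ico 0 p ∪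
      (Finset.Ico p (p + q) ∪ Finset.Ico (p + q + 0) (p + q + 0 + r)) := by
    ext x; simp only [Finset.mem_union, Finset.mem_range, Finset.mem_Ico]; omega
  have e3 : (Finset.Ico p (p + q) ∪ Finset.Ico (p + q + 0) (p + q + 0 + r)).erase (p + q) =
      Finset.Ico p (p + q) ∪ Finset.Ico (p + q + 1) (p + q + 1 + (r - 1)) := by
    ext x; simp only [Finset.mem_erase, Finset.mem_union, Finset.mem_Ico]; omega
  rw [e, pm_bridge _ (Finset.Ico 0 p) _ 0 (p + q)]
  · rw [e3, right 0 r (by omega), right 1 (r - 1) (by omega), cp, ep,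
      path _ _ (by omega) (by omega)]
    rw [show p - 1 + 1 = p by omega, show r - 1 + 1 = r by omega]
  · simp; omega
  · simp; omega
  · rw [Finset.disjoint_left]; intro x; simp only [Finset.mem_union, Finset.mem_Ico]; omega
  · unfold matN relN; rw [if_neg (by omega), if_pos (by omega)]
  · unfold matN relN; rw [if_neg (by omega), if_pos (by omega)]
  · intro i hi b hb hn
    simp only [Finset.mem_union, Finset.mem_Ico] at hi hb
    unfold matN relN; rw [if_neg (by omega), if_neg (by omega)]
  · intro i hi b hb hn
    simp only [Finset.mem_union, Finset.mem_Ico] at hi hb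
    unfold matN relN; rw [if_neg (by omega), if_neg (by omega)]

/-! Closed forms. -/

lemma fibU_closed (s : ℚ) (hs : s ≠ 0) (n : ℕ) :
    (1 + s ^ 2) * s ^ n * fibU (1 / s - s) n = s * (1 - (-1) ^ n * s ^ (2 * n)) := by
  induction n using Nat.twoStepInduction with
  | zero => simp [fibU]
  | one => simp [fibU]; ring
  | more n ih1 ih2 =>
    have e : (1 + s ^ 2) * s ^ (n + 2) * fibU (1 / s - s) (n + 2) =
        (s * (1 / s - s)) * ((1 + s ^ 2) * s ^ (n + 1) * fibU (1 / s - s) (n + 1)) +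
        s ^ 2 * ((1 + s ^ 2) * s ^ n * fibU (1 / s - s) n) := by
      rw [fibU]; ring
    have e2 : s * (1 / s - s) = 1 - s ^ 2 := by field_simp
    rw [e, ih1, ih2, e2]
    ring

/-- Normalised permanent of the cycle part. -/
def ca (s : ℚ) (p : ℕ) : ℚ :=
  (1 - s + s ^ 2) + (-1) ^ p * s ^ (2 * p) * (1 + s + s ^ 2) + 2 * (1 + s ^ 2) * s ^ p

lemma cycA_closed (s : ℚ) (hs : s ≠ 0) (p : ℕ) (hp : 1 ≤ p) :
    (1 + s ^ 2) * s ^ p * cycA (1 / s - s) p = ca s p := by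
  obtain ⟨m, rfl⟩ : ∃ m, p = m + 1 := ⟨p - 1, by omega⟩
  have h1 := fibU_closed s hs (m + 1)
  have h2 := fibU_closed s hs m
  have e2 : s * (1 / s - s) = 1 - s ^ 2 := by field_simp
  have e : (1 + s ^ 2) * s ^ (m + 1) * cycA (1 / s - s) (m + 1) =
      ((1 / s - s) - 1) * ((1 + s ^ 2) * s ^ (m + 1) * fibU (1 / s - s) (m + 1)) +
      2 * s * ((1 + s ^ 2) * s ^ m * fibU (1 / s - s) m) + 2 * (1 + s ^ 2) * s ^ (m + 1) := by
    rw [cycA]; simp only [Nat.add_sub_cancel]; ring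
  rw [e, h1, h2]
  have e3 : (1 / s - s - 1) * (s * (1 - (-1) ^ (m + 1) * s ^ (2 * (m + 1)))) =
      (s * (1 / s - s) - s) * (1 - (-1) ^ (m + 1) * s ^ (2 * (m + 1))) := by ring
  rw [e3, e2, ca]
  ring

lemma total_closed (s : ℚ) (hs : s ≠ 0) (p q r : ℕ) (hp : 1 ≤ p) (hq : 1 ≤ q) (hr : 1 ≤ r) :
    (1 + s ^ 2) ^ 3 * s ^ (p + q + r) *
      (cycA (1 / s - s) p * (cycA (1 / s - s) q * fibU (1 / s - s) (r + 1)
          + fibU (1 / s - s) q * fibU (1 / s - s) r) +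
        fibU (1 / s - s) p * (cycA (1 / s - s) q * fibU (1 / s - s) r
          + fibU (1 / s - s) q * fibU (1 / s - s) (r - 1))) =
    (ca s p + s ^ 2 * (1 - (-1) ^ p * s ^ (2 * p))) * (ca s q + s ^ 2 * (1 - (-1) ^ q * s ^ (2 * q)))
    + (-1) ^ r * s ^ (2 * r + 2) *
      ((ca s p - (1 - (-1) ^ p * s ^ (2 * p))) * (ca s q - (1 - (-1) ^ q * s ^ (2 * q)))) := by
  obtain ⟨m, rfl⟩ : ∃ m, r = m + 1 := ⟨r - 1, by omega⟩
  have hap := cycA_closed s hs p hp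
  have haq := cycA_closed s hs q hq
  have hbp := fibU_closed s hs p
  have hbq := fibU_closed s hs q
  have u0 := fibU_closed s hs m
  have u1 := fibU_closed s hs (m + 1)
  have u2 := fibU_closed s hs (m + 2)
  have u2' : (1 + s ^ 2) * s ^ (m + 1) * fibU (1 / s - s) (m + 2)
      = 1 - (-1) ^ (m + 2) * s ^ (2 * (m + 2)) := by
    apply mul_left_cancel₀ hs
    rw [← u2]; ring
  simp only [Nat.add_sub_cancel]
  generalize 1 / s - s = y at *
  calc _ = ((1 + s ^ 2) * s ^ p * cycA y p) * ((1 + s ^ 2) * s ^ q * cycA y q) *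
        ((1 + s ^ 2) * s ^ (m + 1) * fibU y (m + 2)) +
        (((1 + s ^ 2) * s ^ p * cycA y p) * ((1 + s ^ 2) * s ^ q * fibU y q) +
          ((1 + s ^ 2) * s ^ p * fibU y p) * ((1 + s ^ 2) * s ^ q * cycA y q)) *
        ((1 + s ^ 2) * s ^ (m + 1) * fibU y (m + 1)) +
        ((1 + s ^ 2) * s ^ p * fibU y p) * ((1 + s ^ 2) * s ^ q * fibU y q) *
        (s * ((1 + s ^ 2) * s ^ m * fibU y m)) := by ring
    _ = _ := by
      rw [hap, haq, hbp, hbq, u0, u1, u2']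
      ring

/-! The normalised polynomial. -/

/-- Auxiliary. -/
def aP (p : ℕ) : ℚ[X] := 2 * (1 + X ^ 2) + (-1) ^ p * X ^ p * (1 + X)
/-- Auxiliary. -/
def eP (p : ℕ) : ℚ[X] := 2 * (1 + X ^ 2) + (-1) ^ p * X ^ p * (2 + X + X ^ 2)
/-- Auxiliary. -/
def gP : ℚ[X] := 1 - X + 2 * X ^ 2
/-- Auxiliary. -/
def GP (p : ℕ) : ℚ[X] := gP + X ^ p * aP p
/-- Auxiliary. -/
def KP (p : ℕ) : ℚ[X] := X * (X - 1) + X ^ p * eP p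
/-- The normalised polynomial. -/
def PhiP (p q r : ℕ) : ℚ[X] := GP p * GP q + (-1) ^ r * X ^ (2 * r + 2) * (KP p * KP q)

lemma PhiP_eval (s : ℚ) (p q r : ℕ) :
    (PhiP p q r).eval s =
    (ca s p + s ^ 2 * (1 - (-1) ^ p * s ^ (2 * p))) * (ca s q + s ^ 2 * (1 - (-1) ^ q * s ^ (2 * q)))
    + (-1) ^ r * s ^ (2 * r + 2) *
      ((ca s p - (1 - (-1) ^ p * s ^ (2 * p))) * (ca s q - (1 - (-1) ^ q * s ^ (2 * q)))) := by
  simp only [PhiP, GP, KP, gP, aP, eP, ca, eval_add, eval_mul, eval_sub, eval_pow, eval_neg,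
    eval_one, eval_X, eval_ofNat]
  ring

lemma coeff_low (f : ℚ[X]) (n k : ℕ) (h : k ≤ n) :
    (X ^ n * f).coeff k = if n = k then f.coeff 0 else 0 := by
  rw [coeff_X_pow_mul']
  split_ifs with h1 h2 h2
  · subst h2; simp
  · omega
  · omega
  · rfl

lemma PhiP_symm (p q r : ℕ) : PhiP p q r = PhiP q p r := by
  unfold PhiP; ring

lemma aP_zero (p : ℕ) (hp : 1 ≤ p) : (aP p).eval 0 = 2 := by
  simp [aP, show p ≠ 0 by omega]

lemma gP_zero : gP.eval 0 = 1 := by simp [gP]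

lemma PhiP_zero (p q r : ℕ) (hp : 1 ≤ p) (hq : 1 ≤ q) : (PhiP p q r).coeff 0 = 1 := by
  rw [coeff_zero_eq_eval_zero]
  simp [PhiP, GP, gP_zero, show p ≠ 0 by omega, show q ≠ 0 by omega]

lemma PhiP_coeff (p q r k : ℕ) (hp : 1 ≤ p) (hq : 1 ≤ q) (h1 : k ≤ p) (h2 : k ≤ q) :
    (PhiP p q r).coeff k = (gP ^ 2).coeff k
      + (X ^ (2 * r + 4) * ((-1) ^ r * (X - 1) ^ 2) : ℚ[X]).coeff k
      + (if p = k then 2 else 0) + (if q = k then 2 else 0) := by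
  have e : PhiP p q r = gP ^ 2 + X ^ (2 * r + 4) * ((-1) ^ r * (X - 1) ^ 2)
      + X ^ p * (gP * aP p + (-1) ^ r * X ^ (2 * r + 3) * (X - 1) * eP p)
      + X ^ q * (gP * aP q + (-1) ^ r * X ^ (2 * r + 3) * (X - 1) * eP q
        + X ^ p * (aP p * aP q + (-1) ^ r * X ^ (2 * r + 2) * (eP p * eP q))) := by
    unfold PhiP GP KP; ring
  rw [e, coeff_add, coeff_add, coeff_add, coeff_low _ p k h1, coeff_low _ q k h2]
  congr 2
  · congr 1
    rw [coeff_zero_eq_eval_zero]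
    simp [gP_zero, aP_zero p hp]
  · rw [coeff_zero_eq_eval_zero]
    simp [gP_zero, aP_zero q hq, show p ≠ 0 by omega]

lemma PhiP_coeff' (p q r k : ℕ) (hp : 1 ≤ p) (hq : 1 ≤ q) (h1 : k ≤ p) (h2 : k ≤ q)
    (h3 : k ≤ 2 * r + 4) :
    (PhiP p q r).coeff k = (gP ^ 2).coeff k + (if 2 * r + 4 = k then (-1) ^ r else 0)
      + (if p = k then 2 else 0) + (if q = k then 2 else 0) := by
  rw [PhiP_coeff p q r k hp hq h1 h2, coeff_low _ _ _ h3]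
  congr 4
  rw [coeff_zero_eq_eval_zero]
  simp

lemma PhiP_L2 (p q p' q' r : ℕ) (hp : 1 ≤ p) (h1 : p < p') (h2 : p < q') (h3 : p < q)
    (h : PhiP p q r = PhiP p' q' r) : False := by
  have a := PhiP_coeff p q r p hp (by omega) le_rfl (by omega)
  have b := PhiP_coeff p' q' r p (by omega) (by omega) (by omega) (by omega)
  rw [h, b] at a
  rw [if_neg (by omega), if_neg (by omega), if_pos rfl, if_neg (by omega)] at a
  linarith

lemma PhiP_L3 (p q q' r r' : ℕ) (hp : 3 ≤ p) (hq : 3 ≤ q') (h1 : q' < q) (h2 : r < r')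
    (h : PhiP p q r = PhiP p q' r') : False := by
  obtain ⟨m, rfl⟩ : ∃ m, p = m + 2 := ⟨p - 2, by omega⟩
  obtain ⟨l, rfl⟩ : ∃ m, q = m + 2 := ⟨q - 2, by omega⟩
  obtain ⟨l', rfl⟩ : ∃ m, q' = m + 2 := ⟨q' - 2, by omega⟩
  have e : X ^ (l + 2) * (GP (m + 2) * aP (l + 2))
      + X ^ (2 * r + 4) * ((-1) ^ r * ((X - 1 + X ^ (m + 1) * eP (m + 2)) *
        (X - 1 + X ^ (l + 1) * eP (l + 2)))) =
      X ^ (l' + 2) * (GP (m + 2) * aP (l' + 2))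
      + X ^ (2 * r' + 4) * ((-1) ^ r' * ((X - 1 + X ^ (m + 1) * eP (m + 2)) *
        (X - 1 + X ^ (l' + 1) * eP (l' + 2)))) := by
    have h' := h
    unfold PhiP KP at h'
    rw [GP.eq_1 (l + 2), GP.eq_1 (l' + 2)] at h'
    linear_combination h'
  have hk := congrArg (fun f => coeff f (min (l' + 2) (2 * r + 4))) e
  simp only [coeff_add] at hk
  rw [coeff_low _ _ _ (by omega), coeff_low _ _ _ (by omega), coeff_low _ _ _ (by omega),
    coeff_low _ _ _ (by omega)] at hk
  rw [if_neg (by omega), if_neg (c := 2 * r' + 4 = _) (by omega)] at hk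
  have z1 : (GP (m + 2) * aP (l' + 2)).coeff 0 = 2 := by
    rw [coeff_zero_eq_eval_zero]
    simp [GP, gP_zero, aP_zero]
  have z2 : ((-1) ^ r * ((X - 1 + X ^ (m + 1) * eP (m + 2)) *
        (X - 1 + X ^ (l + 1) * eP (l + 2))) : ℚ[X]).coeff 0 = (-1) ^ r := by
    rw [coeff_zero_eq_eval_zero]
    simp
  rw [z1, z2] at hk
  rcases neg_one_pow_eq_or ℚ r with h0 | h0 <;> rw [h0] at hk <;> split_ifs at hk <;>
    first | omega | norm_num at hk

lemma PhiP_main_aux (p q r p' q' r' : ℕ) (hp : 3 ≤ p) (hp' : 3 ≤ p')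
    (hpq : p ≤ q) (hpq' : p' ≤ q') (hn : p + q + r = p' + q' + r')
    (hm : min p (2 * r + 4) ≤ min p' (2 * r' + 4))
    (h : PhiP p q r = PhiP p' q' r') : p = p' ∧ q = q' ∧ r = r' := by
  obtain ⟨k, hk⟩ : ∃ k, k = min p (2 * r + 4) := ⟨_, rfl⟩
  have k1 : k ≤ p := by omega
  have k2 : k ≤ 2 * r + 4 := by omega
  have k3 : k ≤ p' := by omega
  have k4 : k ≤ 2 * r' + 4 := by omega
  have k5 : k = p ∨ k = 2 * r + 4 := by omega
  clear hk hm
  have a := PhiP_coeff' p q r k (by omega) (by omega) (by omega) (by omega) (by omega)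
  have b := PhiP_coeff' p' q' r' k (by omega) (by omega) (by omega) (by omega) (by omega)
  rw [h, b] at a
  have key : r = r' ∨ p = p' := by
    by_contra hc
    push Not at hc
    obtain ⟨hc1, hc2⟩ := hc
    by_cases c1 : 2 * r + 4 = k
    · rw [if_pos c1, if_neg (show ¬ 2 * r' + 4 = k by omega)] at a
      rcases neg_one_pow_eq_or ℚ r with h0 | h0 <;> rw [h0] at a <;> split_ifs at a <;>
        first | omega | (exfalso; linarith)
    · have c2 : p = k := by omega
      rw [if_neg c1, if_pos c2, if_neg (show ¬ p' = k by omega),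
        if_neg (show ¬ q' = k by omega)] at a
      rcases neg_one_pow_eq_or ℚ r' with h0 | h0 <;> rw [h0] at a <;> split_ifs at a <;>
        first | omega | (exfalso; linarith)
  rcases key with e | e
  · subst e
    rcases lt_trichotomy p p' with h1 | h1 | h1
    · exact (PhiP_L2 p q p' q' r (by omega) h1 (by omega) (by omega) h).elim
    · exact ⟨h1, by omega, rfl⟩
    · exact (PhiP_L2 p' q' p q r (by omega) h1 (by omega) (by omega) h.symm).elim
  · subst e
    rcases lt_trichotomy r r' with h1 | h1 | h1
    · exact (PhiP_L3 p q q' r r' hp (by omega) (by omega) h1 h).elim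
    · exact ⟨rfl, by omega, h1⟩
    · exact (PhiP_L3 p q' q r' r hp (by omega) (by omega) h1 h.symm).elim

lemma PhiP_main_le (p q r p' q' r' : ℕ) (hp : 3 ≤ p) (hp' : 3 ≤ p')
    (hpq : p ≤ q) (hpq' : p' ≤ q') (hn : p + q + r = p' + q' + r')
    (h : PhiP p q r = PhiP p' q' r') : p = p' ∧ q = q' ∧ r = r' := by
  rcases le_total (min p (2 * r + 4)) (min p' (2 * r' + 4)) with hm | hm
  · exact PhiP_main_aux p q r p' q' r' hp hp' hpq hpq' hn hm h
  · have := PhiP_main_aux p' q' r' p q r hp' hp hpq' hpq hn.symm hm h.symm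
    omega

lemma PhiP_main (p q r p' q' r' : ℕ) (hp : 3 ≤ p) (hq : 3 ≤ q) (hp' : 3 ≤ p') (hq' : 3 ≤ q')
    (hn : p + q + r = p' + q' + r') (h : PhiP p q r = PhiP p' q' r') :
    (p = p' ∧ q = q' ∧ r = r') ∨ (p = q' ∧ q = p' ∧ r = r') := by
  rcases le_total p q with h1 | h1 <;> rcases le_total p' q' with h2 | h2
  · have := PhiP_main_le p q r p' q' r' hp hp' h1 h2 hn h
    omega
  · rw [PhiP_symm p' q'] at h
    have := PhiP_main_le p q r q' p' r' hp hq' h1 h2 (by omega) h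
    omega
  · rw [PhiP_symm p q] at h
    have := PhiP_main_le q p r p' q' r' hq hp' h1 h2 (by omega) h
    omega
  · rw [PhiP_symm p' q', PhiP_symm p q] at h
    have := PhiP_main_le q p r q' p' r' hq hq' h1 h2 (by omega) h
    omega

lemma dGraph_adj (p q r : ℕ) (i j : Fin (p + q + r)) :
    (dGraph p q r).Adj i j ↔ (i : ℕ) ≠ j ∧ (relN p q r i j ∨ relN p q r j i) := by
  unfold dGraph relN
  rw [SimpleGraph.fromRel_adj, Ne, Fin.ext_iff]

lemma relN_prev (p q r i : ℕ) (hp : 3 ≤ p) (h0 : i ≠ 0) (h1 : i ≠ p) :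
    relN p q r (if i = p + q then 0 else i - 1) i := by
  unfold relN
  split_ifs with h
  · exact Or.inr (Or.inr (Or.inr (Or.inr (Or.inr (Or.inl ⟨rfl, h⟩)))))
  · by_cases a : i < p
    · exact Or.inl ⟨by omega, a⟩
    by_cases b : i < p + q
    · exact Or.inr (Or.inr (Or.inl ⟨by omega, by omega, b⟩))
    · exact Or.inr (Or.inr (Or.inr (Or.inr (Or.inl ⟨by omega, by omega⟩))))

lemma relN_next (p q r i : ℕ) (hi : i < p + q + r) :
    relN p q r i (if i = p - 1 then 0 else if i = p + q - 1 then p else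
      if i = p + q + r - 1 then p else i + 1) := by
  unfold relN
  split_ifs with h1 h2 h3
  · exact Or.inr (Or.inl ⟨h1, rfl⟩)
  · exact Or.inr (Or.inr (Or.inr (Or.inl ⟨h2, rfl⟩)))
  · exact Or.inr (Or.inr (Or.inr (Or.inr (Or.inr (Or.inr ⟨h3, rfl⟩)))))
  · by_cases a : i < p
    · exact Or.inl ⟨by omega, by omega⟩
    by_cases b : i < p + q
    · exact Or.inr (Or.inr (Or.inl ⟨by omega, by omega, by omega⟩))
    · exact Or.inr (Or.inr (Or.inr (Or.inr (Or.inl ⟨by omega, by omega⟩))))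

lemma relN_cases {p q r i j : ℕ} (hp : 3 ≤ p) (hq : 3 ≤ q) (hr : 1 ≤ r)
    (hi : i < p + q + r) (hj : j < p + q + r) (h : relN p q r i j) :
    (j = (if i = p - 1 then 0 else if i = p + q - 1 then p else
      if i = p + q + r - 1 then p else i + 1)) ∨
    (i = 0 ∧ j = p + q) := by
  unfold relN at h
  rcases h with h | h | h | h | h | h | h <;> split_ifs <;> omega

lemma relN_cases' {p q r i j : ℕ} (hp : 3 ≤ p) (hq : 3 ≤ q) (hr : 1 ≤ r)
    (hi : i < p + q + r) (hj : j < p + q + r) (h : relN p q r i j) :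
    (j = 0 ∧ i = p - 1) ∨ (j = p ∧ (i = p + q - 1 ∨ i = p + q + r - 1)) ∨
    (j ≠ 0 ∧ j ≠ p ∧ i = (if j = p + q then 0 else j - 1)) := by
  unfold relN at h
  rcases h with h | h | h | h | h | h | h <;> split_ifs <;> omega

lemma dGraph_nbrs (p q r : ℕ) (hp : 3 ≤ p) (hq : 3 ≤ q) (hr : 1 ≤ r) (i : Fin (p + q + r)) :
    ((dGraph p q r).neighborFinset i).card = if (i : ℕ) = 0 ∨ (i : ℕ) = p then 3 else 2 := by
  have key : ∀ T : Finset ℕ, (∀ j : ℕ, j ∈ T ↔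
      j < p + q + r ∧ (i : ℕ) ≠ j ∧ (relN p q r i j ∨ relN p q r j i)) →
      ((dGraph p q r).neighborFinset i).card = T.card := by
    intro T hT
    rw [← Finset.card_map Fin.valEmbedding]
    congr 1
    ext j
    rw [hT]
    simp only [Finset.mem_map, SimpleGraph.mem_neighborFinset, dGraph_adj, Fin.valEmbedding_apply]
    constructor
    · rintro ⟨a, ha, rfl⟩
      exact ⟨a.2, ha⟩
    · rintro ⟨h1, h2⟩
      exact ⟨⟨j, h1⟩, h2, rfl⟩
  obtain ⟨i, hi⟩ := i
  simp only at key ⊢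
  by_cases h0 : i = 0
  · rw [key {1, p - 1, p + q}, if_pos (by omega), Finset.card_eq_three.2]
    · exact ⟨1, p - 1, p + q, by omega, by omega, by omega, rfl⟩
    · intro j
      simp only [Finset.mem_insert, Finset.mem_singleton]
      constructor
      · rintro (h | h | h)
        · refine ⟨by omega, by omega, Or.inl (Or.inl ⟨by omega, by omega⟩)⟩
        · refine ⟨by omega, by omega, Or.inr (Or.inr (Or.inl ⟨by omega, by omega⟩))⟩
        · refine ⟨by omega, by omega, Or.inl ?_⟩
          exact Or.inr (Or.inr (Or.inr (Or.inr (Or.inr (Or.inl ⟨h0, h⟩)))))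
      · rintro ⟨hj, hne, h | h⟩
        · have := relN_cases hp hq hr hi hj h
          split_ifs at this <;> omega
        · have := relN_cases' hp hq hr hj hi h
          split_ifs at this <;> omega
  by_cases h1 : i = p
  · rw [key {p + 1, p + q - 1, p + q + r - 1}, if_pos (by omega), Finset.card_eq_three.2]
    · exact ⟨p + 1, p + q - 1, p + q + r - 1, by omega, by omega, by omega, rfl⟩
    · intro j
      simp only [Finset.mem_insert, Finset.mem_singleton]
      constructor
      · rintro (h | h | h)
        · refine ⟨by omega, by omega, Or.inl (Or.inr (Or.inr (Or.inl ?_)))⟩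
          exact ⟨by omega, by omega, by omega⟩
        · refine ⟨by omega, by omega, Or.inr (Or.inr (Or.inr (Or.inr (Or.inl ?_))))⟩
          exact ⟨by omega, by omega⟩
        · refine ⟨by omega, by omega, Or.inr ?_⟩
          exact Or.inr (Or.inr (Or.inr (Or.inr (Or.inr (Or.inr ⟨h, h1⟩)))))
      · rintro ⟨hj, hne, h | h⟩
        · have := relN_cases hp hq hr hi hj h
          split_ifs at this <;> omega
        · have := relN_cases' hp hq hr hj hi h
          split_ifs at this <;> omega
  rw [if_neg (by omega)]
  rw [key {if i = p + q then 0 else i - 1,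
    if i = p - 1 then 0 else if i = p + q - 1 then p else if i = p + q + r - 1 then p else i + 1}]
  · apply Finset.card_pair
    split_ifs <;> omega
  · intro j
    simp only [Finset.mem_insert, Finset.mem_singleton]
    constructor
    · rintro (h | h)
      · refine ⟨by split_ifs at h <;> omega, by split_ifs at h <;> omega, Or.inr ?_⟩
        rw [h]
        exact relN_prev p q r i hp h0 h1
      · refine ⟨by split_ifs at h <;> omega, by split_ifs at h <;> omega, Or.inl ?_⟩
        rw [h]
        exact relN_next p q r i hi
    · rintro ⟨hj, hne, h | h⟩
      · rcases relN_cases hp hq hr hi hj h with h | h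
        · exact Or.inr h
        · omega
      · rcases relN_cases' hp hq hr hj hi h with h | h | h
        · omega
        · omega
        · exact Or.inl h.2.2

lemma lap_entry (p q r : ℕ) (hp : 3 ≤ p) (hq : 3 ≤ q) (hr : 1 ≤ r) (x : ℚ)
    (i j : Fin (p + q + r)) :
    ((Matrix.diagonal (fun _ : Fin (p + q + r) => (X : Polynomial ℚ))
      - ((dGraph p q r).lapMatrix ℚ).map Polynomial.C) i j).eval x = matN p q r (x - 2) i j := by
  have hd : (((dGraph p q r).degree i : ℕ) : ℚ) =
      if (i : ℕ) = 0 ∨ (i : ℕ) = p then 3 else 2 := by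
    have := dGraph_nbrs p q r hp hq hr i
    rw [← SimpleGraph.card_neighborFinset_eq_degree]
    rw [this]
    split_ifs <;> norm_num
  rw [Matrix.sub_apply, eval_sub, Matrix.map_apply, eval_C, SimpleGraph.lapMatrix,
    Matrix.sub_apply, SimpleGraph.degMatrix, SimpleGraph.adjMatrix_apply, matN]
  by_cases h : i = j
  · subst h
    rw [Matrix.diagonal_apply_eq, Matrix.diagonal_apply_eq, hd]
    simp
    split_ifs <;> ring
  · have h' : (i : ℕ) ≠ j := fun e => h (Fin.ext e)
    rw [Matrix.diagonal_apply_ne _ h, Matrix.diagonal_apply_ne _ h, if_neg h']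
    simp only [dGraph_adj, h', ne_eq, not_false_eq_true, true_and]
    split_ifs <;> simp

lemma lap_eval (p q r : ℕ) (hp : 3 ≤ p) (hq : 3 ≤ q) (hr : 1 ≤ r) (x : ℚ) :
    (lapPermPoly (dGraph p q r)).eval x =
      pm (matN p q r (x - 2)) (Finset.range (p + q + r)) (Finset.range (p + q + r)) := by
  unfold lapPermPoly Matrix.permanent
  rw [eval_finsetSum]
  simp only [eval_prod]
  have e : ∀ (σ : Equiv.Perm (Fin (p + q + r))) (i : Fin (p + q + r)),
      eval x ((Matrix.diagonal (fun _ : Fin (p + q + r) => (X : Polynomial ℚ))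
      - ((dGraph p q r).lapMatrix ℚ).map Polynomial.C) (σ i) i)
        = matN p q r (x - 2) (σ i) i := fun σ i => lap_entry p q r hp hq hr x _ _
  rw [pm_transpose, pm]
  let f : Fin (p + q + r) ≃ (Finset.range (p + q + r) : Finset ℕ) :=
    { toFun := fun i => ⟨i, Finset.mem_range.2 i.2⟩
      invFun := fun i => ⟨i, Finset.mem_range.1 i.2⟩
      left_inv := fun _ => rfl
      right_inv := fun _ => rfl }
  rw [← pmT_congr f f _ (fun i j => matN p q r (x - 2) j i) (fun _ _ => rfl)]
  unfold pmT
  refine Finset.sum_congr (by congr!) (fun σ _ => Finset.prod_congr rfl (fun i _ => ?_))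
  first | exact e σ i | (convert e σ i; try rfl)

lemma lap_Phi (p q r : ℕ) (hp : 3 ≤ p) (hq : 3 ≤ q) (hr : 1 ≤ r) (s : ℚ) (hs : s ≠ 0) :
    (1 + s ^ 2) ^ 3 * s ^ (p + q + r) * (lapPermPoly (dGraph p q r)).eval (1 / s - s + 2) =
      (PhiP p q r).eval s := by
  rw [lap_eval p q r hp hq hr, pm_matN p q r _ hp hq hr, PhiP_eval,
    ← total_closed s hs p q r (by omega) (by omega) hr]
  simp only [add_sub_cancel_right]

lemma lap_inj (p q r p' q' r' : ℕ) (hp : 3 ≤ p) (hq : 3 ≤ q) (hr : 1 ≤ r)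
    (hp' : 3 ≤ p') (hq' : 3 ≤ q') (hr' : 1 ≤ r')
    (h : lapPermPoly (dGraph p q r) = lapPermPoly (dGraph p' q' r')) :
    (p = p' ∧ q = q' ∧ r = r') ∨ (p = q' ∧ q = p' ∧ r = r') := by
  have e : X ^ (p' + q' + r') * PhiP p q r = X ^ (p + q + r) * PhiP p' q' r' := by
    apply Polynomial.funext
    intro s
    simp only [eval_mul, eval_pow, eval_X]
    by_cases hs : s = 0
    · subst hs
      rw [zero_pow (by omega), zero_pow (by omega)]; ring
    · rw [← lap_Phi p q r hp hq hr s hs, ← lap_Phi p' q' r' hp' hq' hr' s hs, h]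
      ring
  have hn : p + q + r = p' + q' + r' := by
    have c := congrArg (fun f => coeff f (min (p + q + r) (p' + q' + r'))) e
    rw [coeff_low _ _ _ (by omega), coeff_low _ _ _ (by omega),
      PhiP_zero _ _ _ (by omega) (by omega), PhiP_zero _ _ _ (by omega) (by omega)] at c
    split_ifs at c <;> first | omega | norm_num at c
  rw [hn] at e
  exact PhiP_main p q r p' q' r' hp hq hp' hq' hn
    (mul_left_cancel₀ (pow_ne_zero _ X_ne_zero) e)

/-- The map exchanging the two cycles. -/
def swapN (p q r i : ℕ) : ℕ :=
  if i < p then q + i else if i < p + q then i - p else 2 * (p + q) + r - 1 - i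

lemma swap_a (p q r i : ℕ) (h : i < p) : swapN p q r i = q + i := if_pos h

lemma swap_b (p q r i : ℕ) (h : p ≤ i) (h' : i < p + q) : swapN p q r i = i - p := by
  unfold swapN; rw [if_neg (by omega), if_pos h']

lemma swap_c (p q r i : ℕ) (h : p + q ≤ i) : swapN p q r i = 2 * (p + q) + r - 1 - i := by
  unfold swapN; rw [if_neg (by omega), if_neg (by omega)]

lemma swap_rel (p q r i j : ℕ) (hp : 3 ≤ p) (hq : 3 ≤ q) (hr : 1 ≤ r)
    (hi : i < p + q + r) (hj : j < p + q + r) (h : relN p q r i j) :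
    relN q p r (swapN p q r i) (swapN p q r j) ∨ relN q p r (swapN p q r j) (swapN p q r i) := by
  unfold relN at h
  rcases h with h | h | h | h | h | h | h
  · rw [swap_a p q r i (by omega), swap_a p q r j (by omega)]
    exact Or.inl (Or.inr (Or.inr (Or.inl ⟨by omega, by omega, by omega⟩)))
  · rw [swap_a p q r i (by omega), swap_a p q r j (by omega)]
    exact Or.inl (Or.inr (Or.inr (Or.inr (Or.inl ⟨by omega, by omega⟩))))
  · rw [swap_b p q r i (by omega) (by omega), swap_b p q r j (by omega) (by omega)]
    exact Or.inl (Or.inl ⟨by omega, by omega⟩)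
  · rw [swap_b p q r i (by omega) (by omega), swap_b p q r j (by omega) (by omega)]
    exact Or.inl (Or.inr (Or.inl ⟨by omega, by omega⟩))
  · rw [swap_c p q r i (by omega), swap_c p q r j (by omega)]
    exact Or.inr (Or.inr (Or.inr (Or.inr (Or.inr (Or.inl ⟨by omega, by omega⟩)))))
  · rw [swap_a p q r i (by omega), swap_c p q r j (by omega)]
    exact Or.inr (Or.inr (Or.inr (Or.inr (Or.inr (Or.inr (Or.inr ⟨by omega, by omega⟩))))))
  · rw [swap_c p q r i (by omega), swap_b p q r j (by omega) (by omega)]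
    exact Or.inr (Or.inr (Or.inr (Or.inr (Or.inr (Or.inr (Or.inl ⟨by omega, by omega⟩))))))

lemma swap_lt (p q r i : ℕ) (hi : i < p + q + r) : swapN p q r i < q + p + r := by
  unfold swapN; split_ifs <;> omega

lemma swap_swap (p q r i : ℕ) (hi : i < p + q + r) : swapN q p r (swapN p q r i) = i := by
  unfold swapN; split_ifs <;> omega

lemma swap_adj (p q r i j : ℕ) (hp : 3 ≤ p) (hq : 3 ≤ q) (hr : 1 ≤ r)
    (hi : i < p + q + r) (hj : j < p + q + r)
    (h : i ≠ j ∧ (relN p q r i j ∨ relN p q r j i)) :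
    swapN p q r i ≠ swapN p q r j ∧
    (relN q p r (swapN p q r i) (swapN p q r j) ∨ relN q p r (swapN p q r j) (swapN p q r i)) := by
  refine ⟨fun e => h.1 ?_, ?_⟩
  · rw [← swap_swap p q r i hi, e, swap_swap p q r j hj]
  · rcases h.2 with h | h
    · exact swap_rel p q r i j hp hq hr hi hj h
    · exact (swap_rel p q r j i hp hq hr hj hi h).symm

lemma swap_iso (p q r : ℕ) (hp : 3 ≤ p) (hq : 3 ≤ q) (hr : 1 ≤ r) :
    Nonempty (dGraph p q r ≃g dGraph q p r) := by
  refine ⟨⟨⟨fun i => ⟨swapN p q r i, swap_lt p q r i i.2⟩,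
    fun i => ⟨swapN q p r i, swap_lt q p r i i.2⟩,
    fun i => Fin.ext (swap_swap p q r i i.2), fun i => Fin.ext (swap_swap q p r i i.2)⟩, ?_⟩⟩
  intro i j
  rw [dGraph_adj, dGraph_adj]
  constructor
  · intro h
    have := swap_adj q p r _ _ hq hp hr (swap_lt p q r i i.2) (swap_lt p q r j j.2) h
    rwa [swap_swap p q r i i.2, swap_swap p q r j j.2] at this
  · intro h
    exact swap_adj p q r i j hp hq hr i.2 j.2 h

/-- **Lemma 3.3.** No two non-isomorphic graphs of the form `d(p,q,r)` share the same
Laplacian permanental polynomial. -/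
theorem dGraph_lapPermPoly_injective
    (p q r p' q' r' : ℕ) (hp : 3 ≤ p) (hq : 3 ≤ q) (hr : 1 ≤ r)
    (hp' : 3 ≤ p') (hq' : 3 ≤ q') (hr' : 1 ≤ r')
    (h : lapPermPoly (dGraph p q r) = lapPermPoly (dGraph p' q' r')) :
    Nonempty (dGraph p q r ≃g dGraph p' q' r') := by
  rcases lap_inj p q r p' q' r' hp hq hr hp' hq' hr' h with ⟨rfl, rfl, rfl⟩ | ⟨rfl, rfl, rfl⟩
  · exact ⟨SimpleGraph.Iso.refl⟩
  · exact swap_iso p q r hp hq hr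
end
end

section
/- Let p, q, r ≥ 0 and p', q', r' ≥ 0 be integers, with at most one of p, q, r equal to 0 and at most one of p', q', r' equal to 0. If the graphs θ(p,q,r) and θ(p',q',r') have the same Laplacian permanental polynomial, i.e., per(xI − L(θ(p,q,r))) = per(xI − L(θ(p',q',r'))) as polynomials in x, then θ(p,q,r) is isomorphic to θ(p',q',r') (equivalently, {p,q,r} = {p',q',r'} as multisets). -/
open scoped Classical
open Polynomial

noncomputable section

/-- The bicyclic graph `θ(p,q,r)` on `p + q + r + 2` vertices: the two hub vertices `0`
and `1` are joined by three internally disjoint paths having `p`, `q` and `r` internal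
vertices respectively (internal vertices `2, …, p+1`, then `p+2, …, p+q+1`, then
`p+q+2, …, p+q+r+1`); a path with `0` internal vertices is the edge `{0, 1}`. -/
def thetaGraph (p q r : ℕ) : SimpleGraph (Fin (p + q + r + 2)) :=
  SimpleGraph.fromRel (fun i j =>
    (p = 0 ∧ i.val = 0 ∧ j.val = 1) ∨
    (0 < p ∧ i.val = 0 ∧ j.val = 2) ∨
    (2 ≤ i.val ∧ i.val + 1 = j.val ∧ j.val < p + 2) ∨
    (0 < p ∧ i.val = p + 1 ∧ j.val = 1) ∨
    (q = 0 ∧ i.val = 0 ∧ j.val = 1) ∨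
    (0 < q ∧ i.val = 0 ∧ j.val = p + 2) ∨
    (p + 2 ≤ i.val ∧ i.val + 1 = j.val ∧ j.val < p + q + 2) ∨
    (0 < q ∧ i.val = p + q + 1 ∧ j.val = 1) ∨
    (r = 0 ∧ i.val = 0 ∧ j.val = 1) ∨
    (0 < r ∧ i.val = 0 ∧ j.val = p + q + 2) ∨
    (p + q + 2 ≤ i.val ∧ i.val + 1 = j.val) ∨
    (0 < r ∧ i.val = p + q + r + 1 ∧ j.val = 1))

section PermanentLemmas

set_option linter.unusedSectionVars false

variable {V W R : Type*} [Fintype V] [DecidableEq V] [Fintype W] [DecidableEq W] [CommRing R]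

theorem per_reindex (e : V ≃ W) (M : Matrix W W R) :
    (M.submatrix e e).permanent = M.permanent := by
  unfold Matrix.permanent
  refine Fintype.sum_equiv (Equiv.permCongr e) _ _ ?_
  intro σ
  refine Fintype.prod_equiv e _ _ ?_
  intro i
  simp [Equiv.permCongr_apply]

theorem per_prod_updateRow (M : Matrix V V R) (i : V) (r : V → R) (σ : Equiv.Perm V) :
    ∏ j, (M.updateRow i r) (σ j) j
      = r (σ.symm i) * ∏ j ∈ Finset.univ.erase (σ.symm i), M (σ j) j := by
  rw [← Finset.mul_prod_erase _ _ (Finset.mem_univ (σ.symm i))]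
  congr 1
  · simp
  · refine Finset.prod_congr rfl ?_
    intro j hj
    have : σ j ≠ i := by
      intro h
      apply (Finset.mem_erase.1 hj).1
      rw [← h]; simp
    rw [Matrix.updateRow_ne this]

theorem per_updateRow_add (M : Matrix V V R) (i : V) (r s : V → R) :
    (M.updateRow i (r + s)).permanent
      = (M.updateRow i r).permanent + (M.updateRow i s).permanent := by
  unfold Matrix.permanent
  rw [← Finset.sum_add_distrib]
  refine Finset.sum_congr rfl ?_
  intro σ _
  simp only [per_prod_updateRow, Pi.add_apply, add_mul]

theorem per_option (M : Matrix (Option V) (Option V) R) :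
    M.permanent = M none none * (M.submatrix some some).permanent
      + ∑ a, M (some a) none *
        ((M.submatrix some some).updateRow a
          (fun j => M none (some j))).permanent := by
  unfold Matrix.permanent
  rw [← Equiv.sum_comp (Equiv.Perm.decomposeOption (α := V)).symm, Fintype.sum_prod_type,
    Fintype.sum_option]
  congr 1
  · rw [Finset.mul_sum]
    refine Finset.sum_congr rfl ?_
    intro σ _
    rw [Fintype.prod_option]
    simp
  · refine Finset.sum_congr rfl ?_
    intro a _
    rw [Finset.mul_sum]
    refine Finset.sum_congr rfl ?_
    intro σ _
    rw [Fintype.prod_option]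
    have h0 : (Equiv.Perm.decomposeOption.symm (some a, σ)) none = some a := by
      simp [Equiv.Perm.decomposeOption]
    rw [h0]
    congr 1
    · refine Finset.prod_congr rfl ?_
      intro j _
      by_cases h : σ j = a
      · simp [Equiv.Perm.decomposeOption, h]
      · rw [Matrix.updateRow_ne h]
        have : Equiv.swap none (some a) (some (σ j)) = some (σ j) :=
          Equiv.swap_apply_of_ne_of_ne (by simp) (by simpa using h)
        simp [Equiv.Perm.decomposeOption, this]

/-- add `s` at entry `(i, j)` -/
def bump (B : Matrix V V R) (i j : V) (s : R) : Matrix V V R :=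
  fun k l => B k l + if k = i ∧ l = j then s else 0

theorem per_minor (B : Matrix V V R) (i j : V) (s : R) :
    (B.updateRow i (Pi.single j s)).permanent = (bump B i j s).permanent - B.permanent := by
  have h : bump B i j s = B.updateRow i (B i + Pi.single j s) := by
    ext k l
    by_cases hk : k = i
    · subst hk
      simp [bump, Pi.single_apply]
    · rw [Matrix.updateRow_ne hk]
      simp [bump, hk]
  rw [h, per_updateRow_add, Matrix.updateRow_eq_self]
  ring

/-- add `α, β, γ, δ` at the entries `uu, vv, uv, vu` -/
def pert (B : Matrix V V R) (u v : V) (α β γ δ : R) : Matrix V V R :=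
  fun i j => B i j + (if i = u ∧ j = u then α else 0) + (if i = v ∧ j = v then β else 0)
    + (if i = u ∧ j = v then γ else 0) + (if i = v ∧ j = u then δ else 0)

/-- The dependence of the permanent on the four entries at `u, v`. -/
def PData (B : Matrix V V R) (u v : V) (c0 c1 c2 c3 c4 c5 : R) : Prop :=
  ∀ α β γ δ : R, (pert B u v α β γ δ).permanent
    = c0 + c1 * α + c2 * β + c3 * γ + c4 * δ + c5 * (α * β + γ * δ)

theorem pert_zero (B : Matrix V V R) (u v : V) : pert B u v 0 0 0 0 = B := by
  ext i j; simp [pert]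

theorem PData.per {B : Matrix V V R} {u v : V} {c0 c1 c2 c3 c4 c5 : R}
    (h : PData B u v c0 c1 c2 c3 c4 c5) : B.permanent = c0 := by
  have := h 0 0 0 0
  rw [pert_zero] at this
  rw [this]; ring

theorem pert_pert (B : Matrix V V R) (u v : V) (α β γ δ α' β' γ' δ' : R) :
    pert (pert B u v α β γ δ) u v α' β' γ' δ' = pert B u v (α + α') (β + β') (γ + γ') (δ + δ') := by
  ext i j
  simp only [pert]
  split_ifs <;> ring

theorem PData.shift {B : Matrix V V R} {u v : V} {c0 c1 c2 c3 c4 c5 : R}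
    (h : PData B u v c0 c1 c2 c3 c4 c5) (α β γ δ : R) :
    PData (pert B u v α β γ δ) u v
      (c0 + c1 * α + c2 * β + c3 * γ + c4 * δ + c5 * (α * β + γ * δ))
      (c1 + c5 * β) (c2 + c5 * α) (c3 + c5 * δ) (c4 + c5 * γ) c5 := by
  intro α' β' γ' δ'
  rw [pert_pert, h]
  ring

/-- Attach a new vertex `none` with diagonal entry `y` to `u`. -/
def extM (B : Matrix V V R) (u : V) (y : R) : Matrix (Option V) (Option V) R
  | some i, some j => B i j
  | some i, none => if i = u then 1 else 0
  | none, some j => if j = u then 1 else 0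
  | none, none => y

theorem PData.ext {B : Matrix V V R} {u v : V} {c0 c1 c2 c3 c4 c5 : R}
    (h : PData B u v c0 c1 c2 c3 c4 c5) (y : R) :
    PData (extM B u y) none (some v) (y * c0 + c1) c0 (y * c2 + c5) c3 c4 c2 := by
  intro α β γ δ
  rw [per_option]
  have hB : (pert (extM B u y) none (some v) α β γ δ).submatrix some some
      = pert B u v 0 β 0 0 := by
    ext i j; simp [pert, extM]
  have hrow : (fun j => pert (extM B u y) none (some v) α β γ δ none (some j))
      = (Pi.single u 1 + Pi.single v γ : V → R) := by
    ext j; simp [pert, extM, Pi.single_apply]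
  have hcol : ∀ a, pert (extM B u y) none (some v) α β γ δ (some a) none
      = (if a = u then 1 else 0) + (if a = v then δ else 0) := by
    intro a; simp [pert, extM]
  have e1 : bump (pert B u v 0 β 0 0) u u 1 = pert B u v 1 β 0 0 := by
    ext i j; simp only [bump, pert]; split_ifs <;> ring
  have e2 : bump (pert B u v 0 β 0 0) u v γ = pert B u v 0 β γ 0 := by
    ext i j; simp only [bump, pert]; split_ifs <;> ring
  have e3 : bump (pert B u v 0 β 0 0) v u 1 = pert B u v 0 β 0 1 := by
    ext i j; simp only [bump, pert]; split_ifs <;> ring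
  have e4 : bump (pert B u v 0 β 0 0) v v γ = pert B u v 0 (β + γ) 0 0 := by
    ext i j; simp only [bump, pert]; split_ifs <;> ring
  rw [hB, hrow]
  simp only [hcol, add_mul, ite_mul, one_mul, zero_mul, Finset.sum_add_distrib,
    Finset.sum_ite_eq', Finset.mem_univ, if_true]
  simp only [per_updateRow_add, per_minor, e1, e2, e3, e4, h _ _ _ _]
  simp [pert, extM]
  ring

/-- the sequence `F_{n-2}` of path permanents -/
def fibG (y : R) : ℕ → R
  | 0 => 1
  | 1 => 0
  | n + 2 => y * fibG y (n + 1) + fibG y n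

/-- Attach a path with `p` inner vertices between `u` and `v`. -/
def att (y : R) (B : Matrix V V R) (u v : V) (p : ℕ) : Matrix (V ⊕ Fin p) (V ⊕ Fin p) R
  | Sum.inl i, Sum.inl j => B i j + (if p = 0 ∧ i = u ∧ j = v then 1 else 0)
      + (if p = 0 ∧ i = v ∧ j = u then 1 else 0)
  | Sum.inl i, Sum.inr k => (if i = u ∧ k.val = 0 then 1 else 0)
      + (if i = v ∧ k.val + 1 = p then 1 else 0)
  | Sum.inr k, Sum.inl i => (if i = u ∧ k.val = 0 then 1 else 0)
      + (if i = v ∧ k.val + 1 = p then 1 else 0)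
  | Sum.inr k, Sum.inr l => (if k.val = l.val then y else 0)
      + (if k.val + 1 = l.val then 1 else 0) + (if l.val + 1 = k.val then 1 else 0)

/-- reindexing for the induction -/
def attEquiv (V : Type*) (p : ℕ) : Option V ⊕ Fin p ≃ V ⊕ Fin (p + 1) where
  toFun := fun x => match x with
    | Sum.inl (some i) => Sum.inl i
    | Sum.inl none => Sum.inr 0
    | Sum.inr k => Sum.inr k.succ
  invFun := fun x => match x with
    | Sum.inl i => Sum.inl (some i)
    | Sum.inr k => Fin.cases (Sum.inl none) (fun k => Sum.inr k) k
  left_inv := by rintro ((_ | i) | k) <;> simp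
  right_inv := by
    rintro (i | k)
    · rfl
    · refine Fin.cases ?_ ?_ k
      · rfl
      · intro i; rfl

end PermanentLemmas

theorem per_att {R : Type*} [CommRing R] (y : R) (p : ℕ) :
    ∀ {V : Type*} [Fintype V] [DecidableEq V] (B : Matrix V V R) (u v : V) (_ : u ≠ v)
      (c0 c1 c2 c3 c4 c5 : R) (_ : PData B u v c0 c1 c2 c3 c4 c5),
      (att y B u v p).permanent = fibG y (p + 2) * c0 + fibG y (p + 1) * (c1 + c2)
        + fibG y p * c5 + c3 + c4 := by
  induction p with
  | zero =>
    intro V _ _ B u v huv c0 c1 c2 c3 c4 c5 h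
    have := h 0 0 1 1
    rw [← per_reindex (Equiv.sumEmpty V (Fin 0))] at this
    have e : (pert B u v 0 0 1 1).submatrix (Equiv.sumEmpty V (Fin 0))
        (Equiv.sumEmpty V (Fin 0)) = att y B u v 0 := by
      ext i j
      rcases i with i | i
      · rcases j with j | j
        · change pert B u v 0 0 1 1 i j = _
          simp [pert, att]
        · exact j.elim0
      · exact i.elim0
    rw [e] at this
    rw [this]
    simp [fibG]
    ring
  | succ p ih =>
    intro V _ _ B u v huv c0 c1 c2 c3 c4 c5 h
    rw [← per_reindex (attEquiv V p)]
    have e : (att y B u v (p + 1)).submatrix (attEquiv V p) (attEquiv V p)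
        = att y (extM B u y) none (some v) p := by
      ext i j
      rcases i with (_ | i) | i <;> rcases j with (_ | j) | j <;>
        simp [attEquiv, att, extM, eq_comm, and_comm]
    rw [e, ih _ _ _ (by simp) _ _ _ _ _ _ (h.ext y)]
    have f1 : fibG y (p + 1 + 2) = y * fibG y (p + 2) + fibG y (p + 1) := rfl
    have f2 : fibG y (p + 1 + 1) = y * fibG y (p + 1) + fibG y p := rfl
    rw [f1, f2]
    ring

theorem PData_att {R V : Type*} [CommRing R] [Fintype V] [DecidableEq V] (y : R) (p : ℕ)
    (B : Matrix V V R) (u v : V) (huv : u ≠ v)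
    (c0 c1 c2 c3 c4 c5 : R) (h : PData B u v c0 c1 c2 c3 c4 c5) :
    PData (att y B u v p) (Sum.inl u) (Sum.inl v)
      (fibG y (p + 2) * c0 + fibG y (p + 1) * (c1 + c2) + fibG y p * c5 + c3 + c4)
      (fibG y (p + 2) * c1 + fibG y (p + 1) * c5) (fibG y (p + 2) * c2 + fibG y (p + 1) * c5)
      (fibG y (p + 2) * c3 + c5) (fibG y (p + 2) * c4 + c5) (fibG y (p + 2) * c5) := by
  intro α β γ δ
  have e : pert (att y B u v p) (Sum.inl u) (Sum.inl v) α β γ δ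
      = att y (pert B u v α β γ δ) u v p := by
    ext i j
    rcases i with i | i <;> rcases j with j | j <;> simp [pert, att]
    ring
  rw [e, per_att y p _ u v huv _ _ _ _ _ _ (h.shift α β γ δ)]
  ring_nf

theorem att_rowsum_inl {R V : Type*} [CommRing R] [Fintype V] [DecidableEq V] (y : R)
    (B : Matrix V V R) (u v : V) (p : ℕ) (i : V) :
    ∑ x, att y B u v p (Sum.inl i) x
      = ∑ j, B i j + (if i = u then 1 else 0) + (if i = v then 1 else 0) := by
  rw [Fintype.sum_sum_type]
  simp only [att, Finset.sum_add_distrib]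
  rcases p with _ | p
  · by_cases h1 : i = u
    · subst h1
      by_cases h2 : i = v
      · subst h2; simp
      · simp [h2]
    · by_cases h2 : i = v
      · subst h2; simp [h1]
      · simp [h1, h2]
  · have e1 : ∀ k : Fin (p + 1), (k.val = 0) ↔ k = 0 := fun k => by
      rw [Fin.ext_iff]; simp
    have e2 : ∀ k : Fin (p + 1), (k.val = p) ↔ k = Fin.last p := fun k => by
      rw [Fin.ext_iff]; simp
    by_cases h1 : i = u
    · subst h1
      by_cases h2 : i = v
      · subst h2; simp [e1, e2]; ring
      · simp [h2, e1]
    · by_cases h2 : i = v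
      · subst h2; simp [h1, e2]
      · simp [h1, h2]

theorem att_rowsum_inr {R V : Type*} [CommRing R] [Fintype V] [DecidableEq V] (y : R)
    (B : Matrix V V R) (u v : V) (p : ℕ) (k : Fin p) :
    ∑ x, att y B u v p (Sum.inr k) x = y + 2 := by
  rw [Fintype.sum_sum_type]
  simp only [att, Finset.sum_add_distrib]
  have a1 : ∑ l : Fin p, (if k.val = l.val then y else 0) = y := by
    rw [Finset.sum_eq_single k]
    · simp
    · intro l _ hl
      rw [if_neg]
      intro h; exact hl (Fin.ext h.symm)
    · simp
  have a2 : ∑ x : V, (if x = u ∧ k.val = 0 then (1 : R) else 0) = if k.val = 0 then 1 else 0 := by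
    by_cases h : k.val = 0 <;> simp [h]
  have a3 : ∑ x : V, (if x = v ∧ k.val + 1 = p then (1 : R) else 0)
      = if k.val + 1 = p then 1 else 0 := by
    by_cases h : k.val + 1 = p <;> simp [h]
  have a4 : ∑ l : Fin p, (if k.val + 1 = l.val then (1 : R) else 0)
      = if k.val + 1 = p then 0 else 1 := by
    by_cases h : k.val + 1 = p
    · rw [if_pos h]
      refine Finset.sum_eq_zero ?_
      intro l _
      rw [if_neg]
      have := l.2
      omega
    · rw [if_neg h]
      have hk := k.2
      rw [Finset.sum_eq_single ⟨k.val + 1, by omega⟩]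
      · simp
      · intro l _ hl
        rw [if_neg]
        intro h'; exact hl (Fin.ext h'.symm)
      · simp
  have a5 : ∑ l : Fin p, (if l.val + 1 = k.val then (1 : R) else 0)
      = if k.val = 0 then 0 else 1 := by
    by_cases h : k.val = 0
    · rw [if_pos h]
      refine Finset.sum_eq_zero ?_
      intro l _
      rw [if_neg]
      omega
    · rw [if_neg h]
      have hk := k.2
      rw [Finset.sum_eq_single ⟨k.val - 1, by omega⟩]
      · rw [if_pos]
        show k.val - 1 + 1 = k.val
        omega
      · intro l _ hl
        rw [if_neg]
        intro h'
        apply hl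
        apply Fin.ext
        show l.val = k.val - 1
        omega
      · simp
  rw [a1, a2, a3, a4, a5]
  split_ifs <;> ring

/-- the vertex set of the theta graph in structured form -/
abbrev TV (p q r : ℕ) : Type := ((Fin 2 ⊕ Fin p) ⊕ Fin q) ⊕ Fin r

/-- structured matrix of the theta graph -/
def thetaM {R : Type*} [CommRing R] (y z : R) (p q r : ℕ) : Matrix (TV p q r) (TV p q r) R :=
  att y (att y (att y (Matrix.diagonal (fun _ : Fin 2 => z)) 0 1 p)
    (Sum.inl 0) (Sum.inl 1) q) (Sum.inl (Sum.inl 0)) (Sum.inl (Sum.inl 1)) r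

/-- numbering of the vertices -/
def tvFun (p q r : ℕ) : TV p q r → ℕ
  | Sum.inl (Sum.inl (Sum.inl i)) => i.val
  | Sum.inl (Sum.inl (Sum.inr i)) => 2 + i.val
  | Sum.inl (Sum.inr i) => 2 + p + i.val
  | Sum.inr i => 2 + p + q + i.val

/-- numbering of the vertices as an equivalence -/
def tvEquiv (p q r : ℕ) : TV p q r ≃ Fin (p + q + r + 2) :=
  ((((finSumFinEquiv.sumCongr (Equiv.refl _)).trans finSumFinEquiv).sumCongr
    (Equiv.refl _)).trans finSumFinEquiv).trans (finCongr (by ring))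

theorem tvEquiv_val (p q r : ℕ) (x : TV p q r) : (tvEquiv p q r x).val = tvFun p q r x := by
  rcases x with ((x | x) | x) | x <;> simp [tvEquiv, tvFun]

/-- the directed relation generating the theta graph -/
def tRel (p q r i j : ℕ) : Prop :=
    (p = 0 ∧ i = 0 ∧ j = 1) ∨
    (0 < p ∧ i = 0 ∧ j = 2) ∨
    (2 ≤ i ∧ i + 1 = j ∧ j < p + 2) ∨
    (0 < p ∧ i = p + 1 ∧ j = 1) ∨
    (q = 0 ∧ i = 0 ∧ j = 1) ∨
    (0 < q ∧ i = 0 ∧ j = p + 2) ∨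
    (p + 2 ≤ i ∧ i + 1 = j ∧ j < p + q + 2) ∨
    (0 < q ∧ i = p + q + 1 ∧ j = 1) ∨
    (r = 0 ∧ i = 0 ∧ j = 1) ∨
    (0 < r ∧ i = 0 ∧ j = p + q + 2) ∨
    (p + q + 2 ≤ i ∧ i + 1 = j) ∨
    (0 < r ∧ i = p + q + r + 1 ∧ j = 1)

theorem tRel_hh {p q r x y : ℕ} (hx : x < 2) (hy : y < 2) :
    tRel p q r (x) (y) ↔ x = 0 ∧ y = 1 ∧ (p = 0 ∨ q = 0 ∨ r = 0) := by
  unfold tRel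
  constructor
  · rintro (h | h | h | h | h | h | h | h | h | h | h | h) <;> omega
  · rintro ⟨h1, h2, h | h | h⟩
    · left; omega
    · right; right; right; right; left; omega
    · right; right; right; right; right; right; right; right; left; omega

theorem tRel_hp {p q r x y : ℕ} (hx : x < 2) (hy : y < p) :
    tRel p q r (x) (2 + y) ↔ x = 0 ∧ y = 0 := by
  unfold tRel
  constructor
  · rintro (h | h | h | h | h | h | h | h | h | h | h | h) <;> omega
  · intro h; right; left; omega

theorem tRel_hq {p q r x y : ℕ} (hx : x < 2) (hy : y < q) :
    tRel p q r (x) (2 + p + y) ↔ x = 0 ∧ y = 0 := by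
  unfold tRel
  constructor
  · rintro (h | h | h | h | h | h | h | h | h | h | h | h) <;> omega
  · intro h; right; right; right; right; right; left; omega

theorem tRel_hr {p q r x y : ℕ} (hx : x < 2) (hy : y < r) :
    tRel p q r (x) (2 + p + q + y) ↔ x = 0 ∧ y = 0 := by
  unfold tRel
  constructor
  · rintro (h | h | h | h | h | h | h | h | h | h | h | h) <;> omega
  · intro h; right; right; right; right; right; right; right; right; right; left; omega

theorem tRel_ph {p q r x y : ℕ} (hx : x < p) (hy : y < 2) :
    tRel p q r (2 + x) (y) ↔ y = 1 ∧ x + 1 = p := by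
  unfold tRel
  constructor
  · rintro (h | h | h | h | h | h | h | h | h | h | h | h) <;> omega
  · intro h; right; right; right; left; omega

theorem tRel_pp {p q r x y : ℕ} (hx : x < p) (hy : y < p) :
    tRel p q r (2 + x) (2 + y) ↔ x + 1 = y := by
  unfold tRel
  constructor
  · rintro (h | h | h | h | h | h | h | h | h | h | h | h) <;> omega
  · intro h; right; right; left; omega

theorem tRel_pq {p q r x y : ℕ} (hx : x < p) (hy : y < q) :
    tRel p q r (2 + x) (2 + p + y) ↔ False := by
  unfold tRel
  constructor
  · rintro (h | h | h | h | h | h | h | h | h | h | h | h) <;> omega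
  · exact False.elim

theorem tRel_pr {p q r x y : ℕ} (hx : x < p) (hy : y < r) :
    tRel p q r (2 + x) (2 + p + q + y) ↔ False := by
  unfold tRel
  constructor
  · rintro (h | h | h | h | h | h | h | h | h | h | h | h) <;> omega
  · exact False.elim

theorem tRel_qh {p q r x y : ℕ} (hx : x < q) (hy : y < 2) :
    tRel p q r (2 + p + x) (y) ↔ y = 1 ∧ x + 1 = q := by
  unfold tRel
  constructor
  · rintro (h | h | h | h | h | h | h | h | h | h | h | h) <;> omega
  · intro h; right; right; right; right; right; right; right; left; omega

theorem tRel_qp {p q r x y : ℕ} (hx : x < q) (hy : y < p) :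
    tRel p q r (2 + p + x) (2 + y) ↔ False := by
  unfold tRel
  constructor
  · rintro (h | h | h | h | h | h | h | h | h | h | h | h) <;> omega
  · exact False.elim

theorem tRel_qq {p q r x y : ℕ} (hx : x < q) (hy : y < q) :
    tRel p q r (2 + p + x) (2 + p + y) ↔ x + 1 = y := by
  unfold tRel
  constructor
  · rintro (h | h | h | h | h | h | h | h | h | h | h | h) <;> omega
  · intro h; right; right; right; right; right; right; left; omega

theorem tRel_qr {p q r x y : ℕ} (hx : x < q) (hy : y < r) :
    tRel p q r (2 + p + x) (2 + p + q + y) ↔ False := by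
  unfold tRel
  constructor
  · rintro (h | h | h | h | h | h | h | h | h | h | h | h) <;> omega
  · exact False.elim

theorem tRel_rh {p q r x y : ℕ} (hx : x < r) (hy : y < 2) :
    tRel p q r (2 + p + q + x) (y) ↔ y = 1 ∧ x + 1 = r := by
  unfold tRel
  constructor
  · rintro (h | h | h | h | h | h | h | h | h | h | h | h) <;> omega
  · intro h; right; right; right; right; right; right; right; right; right; right; right; omega

theorem tRel_rp {p q r x y : ℕ} (hx : x < r) (hy : y < p) :
    tRel p q r (2 + p + q + x) (2 + y) ↔ False := by
  unfold tRel
  constructor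
  · rintro (h | h | h | h | h | h | h | h | h | h | h | h) <;> omega
  · exact False.elim

theorem tRel_rq {p q r x y : ℕ} (hx : x < r) (hy : y < q) :
    tRel p q r (2 + p + q + x) (2 + p + y) ↔ False := by
  unfold tRel
  constructor
  · rintro (h | h | h | h | h | h | h | h | h | h | h | h) <;> omega
  · exact False.elim

theorem tRel_rr {p q r x y : ℕ} (hx : x < r) (hy : y < r) :
    tRel p q r (2 + p + q + x) (2 + p + q + y) ↔ x + 1 = y := by
  unfold tRel
  constructor
  · rintro (h | h | h | h | h | h | h | h | h | h | h | h) <;> omega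
  · intro h; right; right; right; right; right; right; right; right; right; right; left; omega

set_option maxHeartbeats 1000000 in
theorem theta_adj {R : Type*} [CommRing R] (p q r : ℕ)
    (h0 : (0 < p ∧ 0 < q) ∨ (0 < p ∧ 0 < r) ∨ (0 < q ∧ 0 < r)) (x y : TV p q r) :
    (if (thetaGraph p q r).Adj (tvEquiv p q r x) (tvEquiv p q r y) then (1 : R) else 0)
      = thetaM 0 0 p q r x y := by
  have key : (thetaGraph p q r).Adj (tvEquiv p q r x) (tvEquiv p q r y) ↔
      (¬ tvFun p q r x = tvFun p q r y ∧ (tRel p q r (tvFun p q r x) (tvFun p q r y) ∨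
        tRel p q r (tvFun p q r y) (tvFun p q r x))) := by
    rw [← tvEquiv_val, ← tvEquiv_val, ← Fin.ext_iff]
    rfl
  simp only [key]
  rcases x with ((x | x) | x) | x <;> rcases y with ((y | y) | y) | y <;>
    simp only [tvFun, thetaM, att, Sum.inl.injEq, reduceCtorEq, Matrix.diagonal_apply,
      false_and, and_false, if_false, add_zero, zero_add, Fin.ext_iff, Fin.val_zero, Fin.val_one,
      ite_self] <;>
    have hx := x.2 <;> have hy := y.2
  · simp only [tRel_hh hx hy, tRel_hh hy hx]
    have hx2 : x.val = 0 ∨ x.val = 1 := by omega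
    have hy2 : y.val = 0 ∨ y.val = 1 := by omega
    have h3 : (p = 0 ∧ q ≠ 0 ∧ r ≠ 0) ∨ (p ≠ 0 ∧ q = 0 ∧ r ≠ 0) ∨ (p ≠ 0 ∧ q ≠ 0 ∧ r = 0) ∨
      (p ≠ 0 ∧ q ≠ 0 ∧ r ≠ 0) := by omega
    rcases h3 with ⟨a, b, c⟩ | ⟨a, b, c⟩ | ⟨a, b, c⟩ | ⟨a, b, c⟩ <;>
      rcases hx2 with hx2 | hx2 <;> rcases hy2 with hy2 | hy2 <;>
      simp [hx2, hy2, a, b, c]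
  · simp only [tRel_hp hx hy, tRel_ph hy hx]
    split_ifs <;> first | rfl | (exfalso; omega) | simp
  · simp only [tRel_hq hx hy, tRel_qh hy hx]
    split_ifs <;> first | rfl | (exfalso; omega) | simp
  · simp only [tRel_hr hx hy, tRel_rh hy hx]
    split_ifs <;> first | rfl | (exfalso; omega) | simp
  · simp only [tRel_ph hx hy, tRel_hp hy hx]
    split_ifs <;> first | rfl | (exfalso; omega) | simp
  · simp only [tRel_pp hx hy, tRel_pp hy hx]
    split_ifs <;> first | rfl | (exfalso; omega) | simp
  · simp [tRel_pq hx hy, tRel_qp hy hx]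
  · simp [tRel_pr hx hy, tRel_rp hy hx]
  · simp only [tRel_qh hx hy, tRel_hq hy hx]
    split_ifs <;> first | rfl | (exfalso; omega) | simp
  · simp [tRel_qp hx hy, tRel_pq hy hx]
  · simp only [tRel_qq hx hy, tRel_qq hy hx]
    split_ifs <;> first | rfl | (exfalso; omega) | simp
  · simp [tRel_qr hx hy, tRel_rq hy hx]
  · simp only [tRel_rh hx hy, tRel_hr hy hx]
    split_ifs <;> first | rfl | (exfalso; omega) | simp
  · simp [tRel_rp hx hy, tRel_pr hy hx]
  · simp [tRel_rq hx hy, tRel_qr hy hx]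
  · simp only [tRel_rr hx hy, tRel_rr hy hx]
    split_ifs <;> first | rfl | (exfalso; omega) | simp

theorem thetaM_rowsum {R : Type*} [CommRing R] (p q r : ℕ) (x : TV p q r) :
    ∑ y, thetaM (0 : R) 0 p q r x y = match x with
      | Sum.inl (Sum.inl (Sum.inl _)) => 3
      | _ => 2 := by
  unfold thetaM
  rcases x with ((x | x) | x) | x
  · simp only [att_rowsum_inl, Matrix.diagonal_apply]
    fin_cases x <;> simp <;> norm_num
  · simp only [att_rowsum_inl, att_rowsum_inr]
    simp
  · simp only [att_rowsum_inl, att_rowsum_inr]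
    simp
  · simp only [att_rowsum_inr]
    simp

theorem thetaM_decomp {R : Type*} [CommRing R] (Y Z : R) (p q r : ℕ) (x y : TV p q r) :
    thetaM Y Z p q r x y = thetaM 0 0 p q r x y + if x = y then (match x with
      | Sum.inl (Sum.inl (Sum.inl _)) => Z
      | _ => Y) else 0 := by
  rcases x with ((x | x) | x) | x <;> rcases y with ((y | y) | y) | y <;>
    simp only [thetaM, att, Matrix.diagonal_apply, Sum.inl.injEq, Sum.inr.injEq, reduceCtorEq,
      Fin.val_inj, if_false, ite_self, zero_add, add_zero] <;> ring

theorem theta_degree (p q r : ℕ)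
    (h0 : (0 < p ∧ 0 < q) ∨ (0 < p ∧ 0 < r) ∨ (0 < q ∧ 0 < r)) (x : TV p q r) :
    ((thetaGraph p q r).degree (tvEquiv p q r x) : ℚ) = match x with
      | Sum.inl (Sum.inl (Sum.inl _)) => 3
      | _ => 2 := by
  rw [SimpleGraph.degree_eq_sum_if_adj, ← thetaM_rowsum (R := ℚ) p q r x,
    ← Equiv.sum_comp (tvEquiv p q r)]
  refine Finset.sum_congr rfl ?_
  intro y _
  rw [← theta_adj p q r h0 x y]

theorem PData_core {R : Type*} [CommRing R] (z : R) :
    PData (Matrix.diagonal (fun _ : Fin 2 => z)) 0 1 (z * z) z z 0 0 1 := by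
  intro α β γ δ
  have hu : (Finset.univ : Finset (Equiv.Perm (Fin 2))) = {1, Equiv.swap 0 1} := by decide
  unfold Matrix.permanent
  rw [hu, Finset.sum_pair (by decide)]
  simp [pert, Fin.prod_univ_two]
  ring

/-- closed form of the permanent -/
def thetaVal {R : Type*} [CommRing R] (y z : R) (p q r : ℕ) : R :=
  z ^ 2 * fibG y (p + 2) * fibG y (q + 2) * fibG y (r + 2)
  + 2 * z * (fibG y (p + 1) * fibG y (q + 2) * fibG y (r + 2)
    + fibG y (p + 2) * fibG y (q + 1) * fibG y (r + 2)
    + fibG y (p + 2) * fibG y (q + 2) * fibG y (r + 1))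
  + (fibG y p * fibG y (q + 2) * fibG y (r + 2)
    + fibG y (p + 2) * fibG y q * fibG y (r + 2)
    + fibG y (p + 2) * fibG y (q + 2) * fibG y r)
  + 2 * (fibG y (p + 1) * fibG y (q + 1) * fibG y (r + 2)
    + fibG y (p + 1) * fibG y (q + 2) * fibG y (r + 1)
    + fibG y (p + 2) * fibG y (q + 1) * fibG y (r + 1))
  + 2 * (fibG y (p + 2) + fibG y (q + 2) + fibG y (r + 2))

theorem thetaM_per {R : Type*} [CommRing R] (y z : R) (p q r : ℕ) :
    (thetaM y z p q r).permanent = thetaVal y z p q r := by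
  unfold thetaM
  have h1 := PData_att y p _ _ _ (by simp) _ _ _ _ _ _ (PData_core z)
  have h2 := PData_att y q _ _ _ (by simp) _ _ _ _ _ _ h1
  have h3 := PData_att y r _ _ _ (by simp) _ _ _ _ _ _ h2
  rw [h3.per]
  unfold thetaVal
  ring

theorem lapPermPoly_theta (p q r : ℕ)
    (h0 : (0 < p ∧ 0 < q) ∨ (0 < p ∧ 0 < r) ∨ (0 < q ∧ 0 < r)) :
    lapPermPoly (thetaGraph p q r) = thetaVal (X - 2 : ℚ[X]) (X - 3) p q r := by
  rw [← thetaM_per]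
  unfold lapPermPoly
  have e : ∀ x y, (Matrix.diagonal (fun _ : Fin (p + q + r + 2) => (X : ℚ[X])) -
      ((thetaGraph p q r).lapMatrix ℚ).map Polynomial.C) (tvEquiv p q r x) (tvEquiv p q r y)
      = thetaM (X - 2 : ℚ[X]) (X - 3) p q r x y := by
    intro x y
    rw [thetaM_decomp, ← theta_adj p q r h0 x y]
    simp only [Matrix.sub_apply, Matrix.map_apply, SimpleGraph.lapMatrix, SimpleGraph.degMatrix,
      Matrix.diagonal_apply, SimpleGraph.adjMatrix_apply, EmbeddingLike.apply_eq_iff_eq,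
      theta_degree p q r h0 x]
    by_cases hxy : x = y
    · subst hxy
      have c2 : (C 2 : ℚ[X]) = 2 := rfl
      have c3 : (C 3 : ℚ[X]) = 3 := rfl
      rcases x with ((x | x) | x) | x <;> simp [c2, c3]
    · simp [hxy, apply_ite C]
  trans (((Matrix.diagonal (fun _ : Fin (p + q + r + 2) => (X : ℚ[X])) -
      ((thetaGraph p q r).lapMatrix ℚ).map Polynomial.C).submatrix (tvEquiv p q r)
        (tvEquiv p q r)).permanent)
  · symm
    convert per_reindex (tvEquiv p q r) _
    rfl
  · congr 1
    ext1 x y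
    exact e x y

theorem fibG_closed {R : Type*} [CommRing R] (t s : R) (hts : t * s = -1) (p : ℕ) :
    (t - s) * fibG (t + s) p = s ^ 2 * t ^ (p + 1) - t ^ 2 * s ^ (p + 1) ∧
    (t - s) * fibG (t + s) (p + 1) = - s * t ^ (p + 1) + t * s ^ (p + 1) := by
  induction p with
  | zero =>
    simp only [fibG]
    constructor
    · linear_combination (t - s) * hts
    · ring
  | succ p ih =>
    obtain ⟨h1, h2⟩ := ih
    constructor
    · rw [h2]
      linear_combination (- s * t ^ (p + 1) + t * s ^ (p + 1)) * hts
    · simp only [fibG]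
      rw [mul_add, ← mul_assoc, mul_comm (t - s) (t + s), mul_assoc, h2, h1]
      ring

theorem fibG_closed2 {R : Type*} [CommRing R] (t s : R) (hts : t * s = -1) (p : ℕ) :
    (t - s) * fibG (t + s) (p + 2) = t ^ (p + 1) - s ^ (p + 1) := by
  have := (fibG_closed t s hts (p + 1)).2
  rw [this]
  linear_combination (s ^ (p + 1) - t ^ (p + 1)) * hts

/-- one summand of the variable part -/
def hh {R : Type*} [CommRing R] (T : R) (a m : ℕ) : R :=
  - (-1) ^ a * ((T - 1) ^ 2 * T ^ (2 * m)) + 2 * ((T ^ 2 + 1) ^ 2 * T ^ (2 * a + m))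
    - 2 * (-1) ^ a * ((T ^ 2 + 1) ^ 2 * T ^ m) + (-1) ^ m * (T ^ 2 * (T + 1) ^ 2 * T ^ (2 * a))

/-- the variable part -/
def KK {R : Type*} [CommRing R] (T : R) (a b c : ℕ) : R :=
  hh T a (b + c) + hh T b (a + c) + hh T c (a + b)

/-- the whole -/
def QQ {R : Type*} [CommRing R] (T : R) (a b c : ℕ) : R :=
  T ^ (2 * (a + b + c)) * (T ^ 2 - T + 2) ^ 2
    - (-1) ^ (a + b + c) * (2 * T ^ 2 + T + 1) ^ 2 + KK T a b c

theorem KK_map {R S : Type*} [CommRing R] [CommRing S] (f : R →+* S) (T : R) (a b c : ℕ) :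
    f (KK T a b c) = KK (f T) a b c := by
  simp [KK, hh, map_ofNat f 2]

theorem QQ_map {R S : Type*} [CommRing R] [CommRing S] (f : R →+* S) (T : R) (a b c : ℕ) :
    f (QQ T a b c) = QQ (f T) a b c := by
  simp [QQ, KK_map, map_ofNat f 2]

theorem thetaVal_QQ (t : ℚ) (ht : t ≠ 0) (p q r : ℕ) :
    (t + t⁻¹) ^ 3 * thetaVal (t - t⁻¹) (t - t⁻¹ - 1) p q r * t ^ ((p + 1) + (q + 1) + (r + 1) + 2)
      = QQ t (p + 1) (q + 1) (r + 1) := by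
  obtain ⟨s, hs⟩ : ∃ s : ℚ, s = - t⁻¹ := ⟨_, rfl⟩
  have hts : t * s = -1 := by rw [hs]; field_simp
  have e1 : t - t⁻¹ = t + s := by rw [hs]; ring
  have e2 : t + t⁻¹ = t - s := by rw [hs]; ring
  rw [e1, e2]
  have key : (t - s) ^ 3 * thetaVal (t + s) (t + s - 1) p q r =
      t ^ (p + 1) * t ^ (q + 1) * t ^ (r + 1) * (t - 2 * s - 1) ^ 2
      - s ^ (p + 1) * s ^ (q + 1) * s ^ (r + 1) * (s - 2 * t - 1) ^ 2
      - (s + 1) ^ 2 * (s ^ (p + 1) * t ^ (q + 1) * t ^ (r + 1)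
        + t ^ (p + 1) * s ^ (q + 1) * t ^ (r + 1) + t ^ (p + 1) * t ^ (q + 1) * s ^ (r + 1))
      + (t + 1) ^ 2 * (t ^ (p + 1) * s ^ (q + 1) * s ^ (r + 1)
        + s ^ (p + 1) * t ^ (q + 1) * s ^ (r + 1) + s ^ (p + 1) * s ^ (q + 1) * t ^ (r + 1))
      + 2 * (t - s) ^ 2 * (t ^ (p + 1) - s ^ (p + 1) + (t ^ (q + 1) - s ^ (q + 1))
        + (t ^ (r + 1) - s ^ (r + 1))) := by
    have hd : t - s ≠ 0 := by
      intro h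
      have : t = s := by linarith
      rw [← this] at hts
      nlinarith [sq_nonneg t]
    have f0 : ∀ n, fibG (t + s) n = (s ^ 2 * t ^ (n + 1) - t ^ 2 * s ^ (n + 1)) / (t - s) := by
      intro n; rw [eq_div_iff hd, mul_comm]; exact (fibG_closed t s hts n).1
    have f1 : ∀ n, fibG (t + s) (n + 1) = (- s * t ^ (n + 1) + t * s ^ (n + 1)) / (t - s) := by
      intro n; rw [eq_div_iff hd, mul_comm]; exact (fibG_closed t s hts n).2
    have f2 : ∀ n, fibG (t + s) (n + 2) = (t ^ (n + 1) - s ^ (n + 1)) / (t - s) := by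
      intro n; rw [eq_div_iff hd, mul_comm]; exact fibG_closed2 t s hts n
    unfold thetaVal
    rw [f2 p, f2 q, f2 r, f1 p, f1 q, f1 r, f0 p, f0 q, f0 r]
    generalize t ^ (p + 1) = A
    generalize t ^ (q + 1) = B
    generalize t ^ (r + 1) = D
    generalize s ^ (p + 1) = A'
    generalize s ^ (q + 1) = B'
    generalize s ^ (r + 1) = D'
    field_simp
    ring
  rw [key]
  unfold QQ KK hh
  generalize p + 1 = a
  generalize q + 1 = b
  generalize r + 1 = c
  have es : ∀ n, s ^ n = (-1) ^ n / t ^ n := by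
    intro n
    rw [hs, ← inv_neg, ← one_div, ← div_pow]
    congr 1
    field_simp
  rw [es a, es b, es c]
  have hs' : s = - 1 / t := by rw [hs]; field_simp
  rw [hs']
  simp only [pow_add, mul_add, two_mul]
  have hA : t ^ a ≠ 0 := pow_ne_zero _ ht
  have hB : t ^ b ≠ 0 := pow_ne_zero _ ht
  have hD : t ^ c ≠ 0 := pow_ne_zero _ ht
  generalize t ^ a = A at *
  generalize t ^ b = B at *
  generalize t ^ c = D at *
  generalize (-1 : ℚ) ^ a = A' at *
  generalize (-1 : ℚ) ^ b = B' at *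
  generalize (-1 : ℚ) ^ c = D' at *
  field_simp
  ring

theorem thetaVal_map {R S : Type*} [CommRing R] [CommRing S] (f : R →+* S) (y z : R) (p q r : ℕ) :
    f (thetaVal y z p q r) = thetaVal (f y) (f z) p q r := by
  have : ∀ n, f (fibG y n) = fibG (f y) n := by
    intro n
    induction n using Nat.strong_induction_on with
    | _ n ih =>
      match n with
      | 0 => simp [fibG]
      | 1 => simp [fibG]
      | n + 2 => simp [fibG, ih n (by omega), ih (n + 1) (by omega)]
  simp [thetaVal, this, map_ofNat f 2]

theorem QQ_eq (p q r p' q' r' : ℕ)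
    (h : thetaVal (X - 2 : ℚ[X]) (X - 3) p q r = thetaVal (X - 2 : ℚ[X]) (X - 3) p' q' r') :
    (X : ℤ[X]) ^ ((p' + 1) + (q' + 1) + (r' + 1)) * QQ X (p + 1) (q + 1) (r + 1)
      = X ^ ((p + 1) + (q + 1) + (r + 1)) * QQ X (p' + 1) (q' + 1) (r' + 1) := by
  apply Polynomial.funext
  intro t
  by_cases ht : t = 0
  · subst ht
    simp
  have ht' : (t : ℚ) ≠ 0 := by exact_mod_cast ht
  have h1 := congrArg (Polynomial.evalRingHom ((t : ℚ) - (t : ℚ)⁻¹ + 2)) h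
  rw [thetaVal_map, thetaVal_map] at h1
  have e1 : (Polynomial.evalRingHom ((t : ℚ) - (t : ℚ)⁻¹ + 2)) (X - 2) = (t : ℚ) - (t : ℚ)⁻¹ := by
    simp
  have e2 : (Polynomial.evalRingHom ((t : ℚ) - (t : ℚ)⁻¹ + 2)) (X - 3)
      = (t : ℚ) - (t : ℚ)⁻¹ - 1 := by
    simp; ring
  rw [e1, e2] at h1
  have k1 := thetaVal_QQ t ht' p q r
  have k2 := thetaVal_QQ t ht' p' q' r'
  rw [h1] at k1
  have g : (t : ℚ) ^ ((p' + 1) + (q' + 1) + (r' + 1)) * QQ (t : ℚ) (p + 1) (q + 1) (r + 1)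
      = (t : ℚ) ^ ((p + 1) + (q + 1) + (r + 1)) * QQ (t : ℚ) (p' + 1) (q' + 1) (r' + 1) := by
    rw [← k1, ← k2]; ring
  have m1 : ∀ a b c, (QQ (t : ℚ) a b c) = ((QQ t a b c : ℤ) : ℚ) := by
    intro a b c
    have := QQ_map (Int.castRingHom ℚ) t a b c
    simpa using this.symm
  rw [m1, m1] at g
  have m2 : ∀ a b c, eval t (QQ (X : ℤ[X]) a b c) = QQ t a b c := by
    intro a b c
    have := QQ_map (Polynomial.evalRingHom t) X a b c
    simpa using this
  simp only [eval_mul, eval_pow, eval_X, m2]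
  exact_mod_cast g

theorem QQ_zero (a b c : ℕ) (ha : 0 < a) (hb : 0 < b) (hc : 0 < c) :
    QQ (0 : ℤ) a b c ≠ 0 := by
  have h1 : a + b ≠ 0 := by omega
  have h2 : a + c ≠ 0 := by omega
  have h3 : b + c ≠ 0 := by omega
  have h4 : a + b + c ≠ 0 := by omega
  have : QQ (0 : ℤ) a b c = - (-1) ^ (a + b + c) := by
    unfold QQ KK hh
    have i1 : 2 * a + (b + c) ≠ 0 := by omega
    have i2 : 2 * b + (a + c) ≠ 0 := by omega
    have i3 : 2 * c + (a + b) ≠ 0 := by omega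
    have j1 : 2 * (a + b) ≠ 0 := by omega
    have j2 : 2 * (a + c) ≠ 0 := by omega
    have j3 : 2 * (b + c) ≠ 0 := by omega
    have j4 : 2 * (a + b + c) ≠ 0 := by omega
    rw [zero_pow i1, zero_pow i2, zero_pow i3, zero_pow j1, zero_pow j2, zero_pow j3, zero_pow j4,
      zero_pow h1, zero_pow h2, zero_pow h3]
    ring
  rw [this]
  rcases neg_one_pow_eq_or ℤ (a + b + c) with h | h <;> rw [h] <;> norm_num

theorem QQ_sum_le (a b c a' b' c' : ℕ) (ha : 0 < a) (hb : 0 < b) (hc : 0 < c)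
    (h : (X : ℤ[X]) ^ (a' + b' + c') * QQ X a b c = X ^ (a + b + c) * QQ X a' b' c') :
    a + b + c ≤ a' + b' + c' := by
  by_contra hlt
  push Not at hlt
  obtain ⟨d, hd⟩ := Nat.exists_eq_add_of_lt hlt
  rw [hd] at h
  have h2 : QQ (X : ℤ[X]) a b c = X ^ (d + 1) * QQ X a' b' c' := by
    apply mul_left_cancel₀ (pow_ne_zero (a' + b' + c') (X_ne_zero : (X : ℤ[X]) ≠ 0))
    rw [h]; ring
  have h3 := congrArg (Polynomial.evalRingHom (0 : ℤ)) h2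
  rw [QQ_map, map_mul, map_pow] at h3
  simp at h3
  exact QQ_zero a b c ha hb hc h3

theorem KK_eq (p q r p' q' r' : ℕ)
    (h : thetaVal (X - 2 : ℚ[X]) (X - 3) p q r = thetaVal (X - 2 : ℚ[X]) (X - 3) p' q' r') :
    p + q + r = p' + q' + r' ∧
      KK (X : ℤ[X]) (p + 1) (q + 1) (r + 1) = KK X (p' + 1) (q' + 1) (r' + 1) := by
  have h1 := QQ_eq p q r p' q' r' h
  have l1 := QQ_sum_le _ _ _ _ _ _ (by omega) (by omega) (by omega) h1
  have l2 := QQ_sum_le _ _ _ _ _ _ (by omega) (by omega) (by omega) h1.symm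
  have e : p + 1 + (q + 1) + (r + 1) = p' + 1 + (q' + 1) + (r' + 1) := by omega
  refine ⟨by omega, ?_⟩
  rw [e] at h1
  have h2 := mul_left_cancel₀ (pow_ne_zero _ (X_ne_zero : (X : ℤ[X]) ≠ 0)) h1
  unfold QQ at h2
  rw [e] at h2
  exact add_left_cancel h2

theorem hh_char_two {R : Type*} [CommRing R] (h2 : (2 : R) = 0) (T : R) (a m : ℕ) :
    hh T a m = ((T + 1) * (T ^ m + T ^ (a + 1))) ^ 2 := by
  have h1 : (-1 : R) = 1 := by linear_combination -h2
  have h3 : T - 1 = T + 1 := by linear_combination -h2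
  unfold hh
  rw [h1, h3, one_pow, one_pow]
  linear_combination ((T ^ 2 + 1) ^ 2 * T ^ (2 * a + m) - (T ^ 2 + 1) ^ 2 * T ^ m
    - (T + 1) ^ 2 * T ^ (2 * m) - (T + 1) ^ 2 * T ^ m * T ^ (a + 1)) * h2

theorem KK_char_two {R : Type*} [CommRing R] (h2 : (2 : R) = 0) (T : R) (p q r : ℕ) :
    T ^ 2 * KK T (p + 1) (q + 1) (r + 1) = ((T + 1) *
      (T ^ 3 * ((T ^ p + 1) * (T ^ q + 1) * (T ^ r + 1)) - T ^ (p + q + r + 3) - T ^ 3)) ^ 2 := by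
  unfold KK
  rw [hh_char_two h2, hh_char_two h2, hh_char_two h2]
  have sq3 : ∀ x y z : R, x ^ 2 + y ^ 2 + z ^ 2 = (x + y + z) ^ 2 := by
    intro x y z
    linear_combination -(x * y + y * z + x * z) * h2
  rw [sq3]
  ring

theorem prod_eq (p q r p' q' r' : ℕ) (hs : p + q + r = p' + q' + r')
    (h : KK (X : ℤ[X]) (p + 1) (q + 1) (r + 1) = KK X (p' + 1) (q' + 1) (r' + 1)) :
    ((X : (ZMod 2)[X]) ^ p + 1) * (X ^ q + 1) * (X ^ r + 1)
      = (X ^ p' + 1) * (X ^ q' + 1) * (X ^ r' + 1) := by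
  have h1 := congrArg (Polynomial.mapRingHom (Int.castRingHom (ZMod 2))) h
  rw [KK_map, KK_map] at h1
  simp only [coe_mapRingHom, map_X] at h1
  have h2 : (2 : (ZMod 2)[X]) = 0 := by
    have : (C (2 : ZMod 2)) = 0 := by
      rw [show (2 : ZMod 2) = 0 from rfl, C_0]
    rw [← this]; rfl
  have h3 := congrArg (fun z => (X : (ZMod 2)[X]) ^ 2 * z) h1
  simp only [KK_char_two h2] at h3
  rw [hs] at h3
  have h4 : ∀ x y : (ZMod 2)[X], x ^ 2 = y ^ 2 → x = y := by
    intro x y hxy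
    have : (x - y) ^ 2 = 0 := by linear_combination hxy + (y ^ 2 - x * y) * h2
    exact sub_eq_zero.1 (pow_eq_zero_iff (two_ne_zero)|>.1 this)
  have h5 := h4 _ _ h3
  have hX : (X : (ZMod 2)[X]) + 1 ≠ 0 := by
    intro h
    have := congrArg (fun z => coeff z 0) h
    simp at this
  have h6 := mul_left_cancel₀ hX h5
  apply mul_left_cancel₀ (pow_ne_zero 3 (X_ne_zero : (X : (ZMod 2)[X]) ≠ 0))
  linear_combination h6

theorem Xp_ne {p : ℕ} (hp : 0 < p) : (X : (ZMod 2)[X]) ^ p + 1 ≠ 0 := by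
  intro h
  have := congrArg (fun z => coeff z 0) h
  simp [hp.ne] at this

theorem Xp_zero : (X : (ZMod 2)[X]) ^ 0 + 1 = 0 := by
  have : (C (2 : ZMod 2)) = 0 := by
    rw [show (2 : ZMod 2) = 0 from rfl, C_0]
  rw [pow_zero, ← this, one_add_one_eq_two]; rfl

theorem pair_eq {q r q' r' : ℕ} (hs : q + r = q' + r')
    (h : ((X : (ZMod 2)[X]) ^ q + 1) * (X ^ r + 1) = (X ^ q' + 1) * (X ^ r' + 1)) :
    (q = q' ∧ r = r') ∨ (q = r' ∧ r = q') := by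
  have h1 : (X : (ZMod 2)[X]) ^ q + X ^ r = X ^ q' + X ^ r' := by
    have e : (X : (ZMod 2)[X]) ^ q * X ^ r = X ^ q' * X ^ r' := by rw [← pow_add, hs, pow_add]
    linear_combination h - e
  by_contra hne
  have n1 : q ≠ q' := by omega
  have n2 : q ≠ r' := by omega
  have n3 : q = r ∨ q ≠ r := by omega
  rcases n3 with n3 | n3
  · have := congrArg (fun z => coeff z q') h1
    have m1 : q' ≠ q := by omega
    have m2 : q' ≠ r := by omega
    have m3 : q' ≠ r' := by omega
    simp [coeff_X_pow, m1, m2, m3] at this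
  · have := congrArg (fun z => coeff z q) h1
    simp [coeff_X_pow, n1, n2, n3] at this

theorem hh_coeff_aux (P : ℤ[X]) (d n k : ℕ) (hP : P.natDegree ≤ d) (hk : n + d < k) :
    (P * X ^ n).coeff k = 0 := by
  rw [coeff_mul_X_pow', if_pos (by omega)]
  exact coeff_eq_zero_of_natDegree_lt (by omega)

theorem hh_coeff_sign (e k : ℕ) (P : ℤ[X]) (h : P.coeff k = 0) :
    ((-1) ^ e * P).coeff k = 0 := by
  rcases neg_one_pow_eq_or ℤ[X] e with h' | h' <;> rw [h'] <;> simp [h]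

theorem hh_coeff (a m k : ℕ) (h1 : 2 * m + 2 < k) (h2 : m + 4 < k) (h3 : 2 * a + 4 < k) :
    (hh (X : ℤ[X]) a m).coeff k
      = 2 * ((X ^ 2 + 1) ^ 2 * (X : ℤ[X]) ^ (2 * a + m)).coeff k := by
  have z1 : ((-1) ^ a * (((X : ℤ[X]) - 1) ^ 2 * X ^ (2 * m))).coeff k = 0 :=
    hh_coeff_sign _ _ _ (hh_coeff_aux _ 2 _ _ (by compute_degree) (by omega))
  have z2 : ((-1) ^ a * (((X : ℤ[X]) ^ 2 + 1) ^ 2 * X ^ m)).coeff k = 0 :=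
    hh_coeff_sign _ _ _ (hh_coeff_aux _ 4 _ _ (by compute_degree) (by omega))
  have z3 : ((-1) ^ m * ((X : ℤ[X]) ^ 2 * (X + 1) ^ 2 * X ^ (2 * a))).coeff k = 0 :=
    hh_coeff_sign _ _ _ (hh_coeff_aux _ 4 _ _ (by compute_degree) (by omega))
  have e : hh (X : ℤ[X]) a m = - ((-1) ^ a * (((X : ℤ[X]) - 1) ^ 2 * X ^ (2 * m)))
      + C 2 * ((X ^ 2 + 1) ^ 2 * (X : ℤ[X]) ^ (2 * a + m))
      - C 2 * ((-1) ^ a * (((X : ℤ[X]) ^ 2 + 1) ^ 2 * X ^ m))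
      + ((-1) ^ m * ((X : ℤ[X]) ^ 2 * (X + 1) ^ 2 * X ^ (2 * a))) := by
    have : (C 2 : ℤ[X]) = 2 := rfl
    rw [this]
    unfold hh
    ring
  rw [e, coeff_add, coeff_sub, coeff_add, coeff_neg, coeff_C_mul, coeff_C_mul, z1, z2, z3]
  ring

theorem hh_coeff_zero (a m k : ℕ) (h1 : 2 * m + 2 < k) (h2 : m + 4 < k) (h3 : 2 * a + 4 < k)
    (h4 : 2 * a + m + 4 < k) : (hh (X : ℤ[X]) a m).coeff k = 0 := by
  rw [hh_coeff a m k h1 h2 h3, hh_coeff_aux _ 4 _ _ (by compute_degree) (by omega), mul_zero]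

theorem hh_coeff_two (a m k : ℕ) (h1 : 2 * m + 2 < k) (h2 : m + 4 < k) (h3 : 2 * a + 4 < k)
    (h4 : k = 2 * a + m + 4) : (hh (X : ℤ[X]) a m).coeff k = 2 := by
  rw [hh_coeff a m k h1 h2 h3, coeff_mul_X_pow', if_pos (by omega),
    show k - (2 * a + m) = 4 by omega]
  have : ((X : ℤ[X]) ^ 2 + 1) ^ 2 = X ^ 4 + C 2 * X ^ 2 + C 1 := by
    have : (C 2 : ℤ[X]) = 2 := rfl
    rw [this, C_1]; ring
  rw [this]
  simp [coeff_X_pow, coeff_one]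

theorem KK_swap1 {R : Type*} [CommRing R] (T : R) (a b c : ℕ) : KK T a b c = KK T b a c := by
  unfold KK
  rw [Nat.add_comm b a]
  ring

theorem KK_swap2 {R : Type*} [CommRing R] (T : R) (a b c : ℕ) : KK T a b c = KK T a c b := by
  unfold KK
  rw [Nat.add_comm b c]
  ring

theorem exotic (α β : ℕ) (h1 : 1 ≤ α) (h2 : α < β)
    (h : KK (X : ℤ[X]) (α + 1) (α + 1) (2 * β + 1) = KK X (β + 1) (β + 1) (2 * α + 1)) : False := by
  have h3 := congrArg (fun z => coeff z (2 * α + 4 * β + 8)) h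
  unfold KK at h3
  simp only [coeff_add] at h3
  rw [hh_coeff_two (2 * β + 1) _ _ (by omega) (by omega) (by omega) (by omega),
    hh_coeff_zero (α + 1) _ _ (by omega) (by omega) (by omega) (by omega),
    hh_coeff_zero (β + 1) _ _ (by omega) (by omega) (by omega) (by omega),
    hh_coeff_zero (2 * α + 1) _ _ (by omega) (by omega) (by omega) (by omega)] at h3
  norm_num at h3

theorem zero_case (q r q' r' : ℕ) (hq : 1 ≤ q) (hqr : q ≤ r) (hq' : 1 ≤ q') (hqr' : q' ≤ r')
    (hs : q + r = q' + r') (hlt : r' < r)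
    (h : KK (X : ℤ[X]) 1 (q + 1) (r + 1) = KK X 1 (q' + 1) (r' + 1)) : False := by
  unfold KK at h
  have e : q + 1 + (r + 1) = q' + 1 + (r' + 1) := by omega
  rw [e] at h
  have h' : hh (X : ℤ[X]) (q + 1) (1 + (r + 1)) + hh X (r + 1) (1 + (q + 1))
      = hh X (q' + 1) (1 + (r' + 1)) + hh X (r' + 1) (1 + (q' + 1)) := by
    linear_combination h
  have h3 := congrArg (fun z => coeff z (2 * r + q + 8)) h'
  simp only [coeff_add] at h3
  rw [hh_coeff_two (r + 1) _ _ (by omega) (by omega) (by omega) (by omega),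
    hh_coeff_zero (q + 1) _ _ (by omega) (by omega) (by omega) (by omega),
    hh_coeff_zero (q' + 1) _ _ (by omega) (by omega) (by omega) (by omega),
    hh_coeff_zero (r' + 1) _ _ (by omega) (by omega) (by omega) (by omega)] at h3
  norm_num at h3

theorem case_A_aux (p q r p' q' r' : ℕ) (hp : 1 ≤ p) (hpq : p < q) (hqr : q ≤ r)
    (hpq' : p' < q') (hqr' : q' ≤ r') (hlt : p < p')
    (h : ((X : (ZMod 2)[X]) ^ p + 1) * (X ^ q + 1) * (X ^ r + 1)
      = (X ^ p' + 1) * (X ^ q' + 1) * (X ^ r' + 1)) : False := by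
  have e : ∀ p q r : ℕ, ((X : (ZMod 2)[X]) ^ p + 1) * (X ^ q + 1) * (X ^ r + 1)
      = X ^ p + X ^ q + X ^ r + X ^ (p + q) + X ^ (p + r) + X ^ (q + r) + X ^ (p + q + r)
        + X ^ 0 := by
    intro p q r; ring
  rw [e, e] at h
  have h1 := congrArg (fun z => coeff z p) h
  simp only [coeff_add, coeff_X_pow] at h1
  rw [if_pos trivial, if_neg (show p ≠ q by omega), if_neg (show p ≠ r by omega),
    if_neg (show p ≠ p + q by omega), if_neg (show p ≠ p + r by omega),
    if_neg (show p ≠ q + r by omega), if_neg (show p ≠ p + q + r by omega),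
    if_neg (show p ≠ 0 by omega), if_neg (show p ≠ p' by omega),
    if_neg (show p ≠ q' by omega), if_neg (show p ≠ r' by omega),
    if_neg (show p ≠ p' + q' by omega), if_neg (show p ≠ p' + r' by omega),
    if_neg (show p ≠ q' + r' by omega), if_neg (show p ≠ p' + q' + r' by omega)] at h1
  simp at h1

theorem sq_eq (p : ℕ) : ((X : (ZMod 2)[X]) ^ p + 1) * (X ^ p + 1) = X ^ (2 * p) + 1 := by
  have : (2 : (ZMod 2)[X]) = 0 := by
    have := Xp_zero
    rw [pow_zero, one_add_one_eq_two] at this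
    exact this
  linear_combination (X ^ p) * this

theorem case_B_aux (p r p' q' r' : ℕ) (hp : 1 ≤ p) (hqr : p ≤ r) (hp' : 1 ≤ p')
    (hpq' : p' < q') (hqr' : q' ≤ r') (hs : p + p + r = p' + q' + r')
    (h : ((X : (ZMod 2)[X]) ^ p + 1) * (X ^ p + 1) * (X ^ r + 1)
      = (X ^ p' + 1) * (X ^ q' + 1) * (X ^ r' + 1)) : p' = 2 * p ∧ q' = r' ∧ r = 2 * q' := by
  rw [sq_eq] at h
  have hpp : p' = 2 * p := by
    by_contra hne
    have hne2 : p' ≠ r := by omega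
    have e : ∀ p q r : ℕ, ((X : (ZMod 2)[X]) ^ p + 1) * (X ^ q + 1) * (X ^ r + 1)
      = X ^ p + X ^ q + X ^ r + X ^ (p + q) + X ^ (p + r) + X ^ (q + r) + X ^ (p + q + r)
        + X ^ 0 := by
      intro p q r; ring
    have e2 : ((X : (ZMod 2)[X]) ^ (2 * p) + 1) * (X ^ r + 1)
      = X ^ (2 * p) + X ^ r + X ^ (2 * p + r) + X ^ 0 := by ring
    rw [e, e2] at h
    have h1 := congrArg (fun z => coeff z p') h
    simp only [coeff_add, coeff_X_pow] at h1
    rw [if_pos trivial, if_neg (show p' ≠ q' by omega), if_neg (show p' ≠ r' by omega),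
      if_neg (show p' ≠ p' + q' by omega), if_neg (show p' ≠ p' + r' by omega),
      if_neg (show p' ≠ q' + r' by omega), if_neg (show p' ≠ p' + q' + r' by omega),
      if_neg (show p' ≠ 0 by omega), if_neg hne, if_neg hne2,
      if_neg (show p' ≠ 2 * p + r by omega)] at h1
    simp at h1
  subst hpp
  rw [mul_assoc] at h
  have h2 := mul_left_cancel₀ (Xp_ne (p := 2 * p) (by omega)) h
  have hr : r = q' + r' := by omega
  have hqr2 : q' = r' := by
    by_contra hne
    rw [hr] at h2
    have h3 : (X : (ZMod 2)[X]) ^ q' + X ^ r' = 0 := by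
      linear_combination -h2
    have h4 := congrArg (fun z => coeff z q') h3
    simp [coeff_X_pow, hne] at h4
  exact ⟨rfl, hqr2, by omega⟩

theorem sorted_unique (p q r p' q' r' : ℕ) (hpq : p ≤ q) (hqr : q ≤ r) (hq : 1 ≤ q)
    (hpq' : p' ≤ q') (hqr' : q' ≤ r') (hq' : 1 ≤ q') (hs : p + q + r = p' + q' + r')
    (h : KK (X : ℤ[X]) (p + 1) (q + 1) (r + 1) = KK X (p' + 1) (q' + 1) (r' + 1)) :
    p = p' ∧ q = q' ∧ r = r' := by
  have hP := prod_eq p q r p' q' r' hs h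
  have z : p = 0 ↔ p' = 0 := by
    constructor
    · intro h0
      by_contra h1
      rw [h0, Xp_zero, zero_mul, zero_mul] at hP
      exact mul_ne_zero (mul_ne_zero (Xp_ne (p := p') (by omega)) (Xp_ne (p := q') (by omega)))
        (Xp_ne (p := r') (by omega)) hP.symm
    · intro h0
      by_contra h1
      rw [h0, Xp_zero, zero_mul, zero_mul] at hP
      exact mul_ne_zero (mul_ne_zero (Xp_ne (p := p) (by omega)) (Xp_ne (p := q) (by omega)))
        (Xp_ne (p := r) (by omega)) hP
  by_cases hp : p = 0
  · have hp' := z.1 hp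
    subst hp
    subst hp'
    rcases lt_trichotomy r r' with hl | hl | hl
    · exact (zero_case q' r' q r hq' hqr' hq hqr (by omega) hl h.symm).elim
    · exact ⟨rfl, by omega, hl⟩
    · exact (zero_case q r q' r' hq hqr hq' hqr' (by omega) hl h).elim
  · have hp' : p' ≠ 0 := fun h => hp (z.2 h)
    rcases hpq.lt_or_eq with hA | hA
    · rcases hpq'.lt_or_eq with hB | hB
      · have hpp : p = p' := by
          rcases lt_trichotomy p p' with hl | hl | hl
          · exact (case_A_aux p q r p' q' r' (by omega) hA hqr hB hqr' hl hP).elim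
          · exact hl
          · exact (case_A_aux p' q' r' p q r (by omega) hB hqr' hA hqr hl hP.symm).elim
        subst hpp
        rw [mul_assoc, mul_assoc] at hP
        have := pair_eq (by omega) (mul_left_cancel₀ (Xp_ne (p := p) (by omega)) hP)
        omega
      · subst hB
        obtain ⟨e1, e2, e3⟩ := case_B_aux p' r' p q r (by omega) hqr' (by omega) hA hqr hs.symm
          hP.symm
        subst e1
        subst e2
        subst e3
        rw [KK_swap1, KK_swap2] at h
        exact (exotic p' q (by omega) (by omega) h.symm).elim
    · subst hA
      rcases hpq'.lt_or_eq with hB | hB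
      · obtain ⟨e1, e2, e3⟩ := case_B_aux p r p' q' r' (by omega) hqr (by omega) hB hqr' hs hP
        subst e1
        subst e2
        subst e3
        rw [KK_swap1 X (2 * p + 1), KK_swap2 X _ (2 * p + 1)] at h
        exact (exotic p q' (by omega) (by omega) h).elim
      · subst hB
        rw [sq_eq, sq_eq] at hP
        rcases pair_eq (by omega) hP with ⟨e1, e2⟩ | ⟨e1, e2⟩
        · omega
        · subst e1
          subst e2
          rcases lt_trichotomy p p' with hl | hl | hl
          · exact (exotic p p' (by omega) hl h).elim
          · omega
          · exact (exotic p' p (by omega) hl h.symm).elim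

theorem theta_iso {p q r p' q' r' : ℕ}
    (h0 : (0 < p ∧ 0 < q) ∨ (0 < p ∧ 0 < r) ∨ (0 < q ∧ 0 < r))
    (h0' : (0 < p' ∧ 0 < q') ∨ (0 < p' ∧ 0 < r') ∨ (0 < q' ∧ 0 < r'))
    (e : TV p q r ≃ TV p' q' r')
    (hM : ∀ x y, thetaM (0 : ℚ) 0 p' q' r' (e x) (e y) = thetaM 0 0 p q r x y) :
    Nonempty (thetaGraph p q r ≃g thetaGraph p' q' r') := by
  refine ⟨⟨((tvEquiv p q r).symm.trans e).trans (tvEquiv p' q' r'), ?_⟩⟩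
  intro a b
  obtain ⟨x, rfl⟩ := (tvEquiv p q r).surjective a
  obtain ⟨y, rfl⟩ := (tvEquiv p q r).surjective b
  have h := hM x y
  rw [← theta_adj p q r h0, ← theta_adj p' q' r' h0'] at h
  simp only [Equiv.trans_apply, Equiv.symm_apply_apply]
  split_ifs at h with h1 h2 h2
  · exact iff_of_true h1 h2
  · norm_num at h
  · norm_num at h
  · exact iff_of_false h1 h2

/-- swapping the last two blocks -/
def rsw (A B D : Type) : (A ⊕ B) ⊕ D ≃ (A ⊕ D) ⊕ B where
  toFun := fun x => match x with
    | Sum.inl (Sum.inl i) => Sum.inl (Sum.inl i)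
    | Sum.inl (Sum.inr i) => Sum.inr i
    | Sum.inr i => Sum.inl (Sum.inr i)
  invFun := fun x => match x with
    | Sum.inl (Sum.inl i) => Sum.inl (Sum.inl i)
    | Sum.inl (Sum.inr i) => Sum.inr i
    | Sum.inr i => Sum.inl (Sum.inr i)
  left_inv := by rintro ((i | i) | i) <;> rfl
  right_inv := by rintro ((i | i) | i) <;> rfl

theorem iso_swap1 {p q r : ℕ} (h0 : (0 < p ∧ 0 < q) ∨ (0 < p ∧ 0 < r) ∨ (0 < q ∧ 0 < r)) :
    Nonempty (thetaGraph p q r ≃g thetaGraph q p r) := by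
  refine theta_iso h0 (by omega) ((rsw (Fin 2) (Fin p) (Fin q)).sumCongr (Equiv.refl (Fin r))) ?_
  intro x y
  rcases x with ((x | x) | x) | x <;> rcases y with ((y | y) | y) | y <;>
    simp [rsw, thetaM, att]
  ring

theorem iso_swap2 {p q r : ℕ} (h0 : (0 < p ∧ 0 < q) ∨ (0 < p ∧ 0 < r) ∨ (0 < q ∧ 0 < r)) :
    Nonempty (thetaGraph p q r ≃g thetaGraph p r q) := by
  refine theta_iso h0 (by omega) (rsw (Fin 2 ⊕ Fin p) (Fin q) (Fin r)) ?_
  intro x y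
  rcases x with ((x | x) | x) | x <;> rcases y with ((y | y) | y) | y <;>
    simp [rsw, thetaM, att]
  ring

theorem thetaVal_swap1 {R : Type*} [CommRing R] (y z : R) (p q r : ℕ) :
    thetaVal y z p q r = thetaVal y z q p r := by
  unfold thetaVal; ring

theorem thetaVal_swap2 {R : Type*} [CommRing R] (y z : R) (p q r : ℕ) :
    thetaVal y z p q r = thetaVal y z p r q := by
  unfold thetaVal; ring

/-- equivalence of parameter triples -/
def Good (p q r a b c : ℕ) : Prop :=
  Nonempty (thetaGraph p q r ≃g thetaGraph a b c) ∧
    thetaVal (X - 2 : ℚ[X]) (X - 3) p q r = thetaVal (X - 2 : ℚ[X]) (X - 3) a b c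

theorem Good.trans {p q r a b c u v w : ℕ} (h1 : Good p q r a b c) (h2 : Good a b c u v w) :
    Good p q r u v w := by
  obtain ⟨⟨e1⟩, h1⟩ := h1
  obtain ⟨⟨e2⟩, h2⟩ := h2
  exact ⟨⟨e1.trans e2⟩, h1.trans h2⟩

theorem exists_sorted (p q r : ℕ) (h0 : (0 < p ∧ 0 < q) ∨ (0 < p ∧ 0 < r) ∨ (0 < q ∧ 0 < r)) :
    ∃ a b c, Good p q r a b c ∧ a ≤ b ∧ b ≤ c ∧ 1 ≤ b := by
  have s1 : ∀ {p q r : ℕ}, ((0 < p ∧ 0 < q) ∨ (0 < p ∧ 0 < r) ∨ (0 < q ∧ 0 < r)) →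
      Good p q r q p r := fun h => ⟨iso_swap1 h, thetaVal_swap1 _ _ _ _ _⟩
  have s2 : ∀ {p q r : ℕ}, ((0 < p ∧ 0 < q) ∨ (0 < p ∧ 0 < r) ∨ (0 < q ∧ 0 < r)) →
      Good p q r p r q := fun h => ⟨iso_swap2 h, thetaVal_swap2 _ _ _ _ _⟩
  have hid : Good p q r p q r := ⟨⟨RelIso.refl _⟩, rfl⟩
  rcases le_total p q with h1 | h1 <;> rcases le_total q r with h2 | h2 <;>
    rcases le_total p r with h3 | h3
  · exact ⟨p, q, r, hid, h1, h2, by omega⟩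
  · exact ⟨p, q, r, hid, h1, h2, by omega⟩
  · exact ⟨p, r, q, s2 h0, h3, h2, by omega⟩
  · exact ⟨r, p, q, (s2 h0).trans (s1 (by omega)), h3, h1, by omega⟩
  · exact ⟨q, p, r, s1 h0, h1, h3, by omega⟩
  · exact ⟨q, r, p, (s1 h0).trans (s2 (by omega)), h2, h3, by omega⟩
  · exact ⟨r, q, p, ((s1 h0).trans (s2 (by omega))).trans (s1 (by omega)), h2, h1, by omega⟩
  · exact ⟨r, q, p, ((s1 h0).trans (s2 (by omega))).trans (s1 (by omega)), h2, h1, by omega⟩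

/-- **Lemma 3.4.** No two non-isomorphic graphs of the form `θ(p,q,r)` share the same
Laplacian permanental polynomial. -/
theorem thetaGraph_lapPermPoly_injective
    (p q r p' q' r' : ℕ) (h0 : (0 < p ∧ 0 < q) ∨ (0 < p ∧ 0 < r) ∨ (0 < q ∧ 0 < r))
    (h0' : (0 < p' ∧ 0 < q') ∨ (0 < p' ∧ 0 < r') ∨ (0 < q' ∧ 0 < r'))
    (h : lapPermPoly (thetaGraph p q r) = lapPermPoly (thetaGraph p' q' r')) :
    Nonempty (thetaGraph p q r ≃g thetaGraph p' q' r') := by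
  rw [lapPermPoly_theta p q r h0, lapPermPoly_theta p' q' r' h0'] at h
  obtain ⟨a, b, c, ⟨⟨e1⟩, v1⟩, hab, hbc, hb⟩ := exists_sorted p q r h0
  obtain ⟨a', b', c', ⟨⟨e2⟩, v2⟩, hab', hbc', hb'⟩ := exists_sorted p' q' r' h0'
  obtain ⟨hs, hK⟩ := KK_eq a b c a' b' c' (by rw [← v1, ← v2, h])
  obtain ⟨rfl, rfl, rfl⟩ := sorted_unique a b c a' b' c' hab hbc hb hab' hbc' hb' hs hK
  exact ⟨e1.trans e2.symm⟩
end
end
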